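/- arXiv:cond-mat/9712219 — 6 statements merged into one kernel-verified Lean document; each statement's English description precedes it below -/
import Mathlib

section
/- Let N ≥ 1 and let M = (m_{i,j})_{i,j=1,...,N} be an N×N real symmetric matrix such that m_{i,j} ≤ 0 for all i ≠ j, and such that for any i ≠ j there is a finite sequence (i_1,...,i_K) with i_1 = i, i_K = j and m_{i_k,i_{k+1}} ≠ 0 for all k < K. If u ∈ ℝ^N is a nonzero eigenvector of M satisfying u_i ≥ 0 for all i, then u_i > 0 for all i. -/
/-- The zero set of a nonnegative eigenvector of a matrix with nonpositive off-diagonal entries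
is closed under passing from `i` to `j` whenever the entry `M i j` is nonzero. -/
theorem Matrix.eigenvector_apply_eq_zero_of_apply_ne_zero {n R : Type*} [Fintype n]
    [CommRing R] [LinearOrder R] [IsStrictOrderedRing R] {M : Matrix n n R}
    (hoff : ∀ i j, i ≠ j → M i j ≤ 0) {u : n → R} {μ : R}
    (heig : M.mulVec u = μ • u) (hnn : ∀ i, 0 ≤ u i) {i j : n}
    (hi : u i = 0) (hij : M i j ≠ 0) : u j = 0 := by
  have hsum : ∑ k, M i k * u k = 0 := by
    simpa [Matrix.mulVec, dotProduct, hi] using congrFun heig i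
  have hterm : ∀ k ∈ Finset.univ, M i k * u k ≤ 0 := by
    intro k _
    by_cases hk : i = k
    · simp [← hk, hi]
    · exact mul_nonpos_of_nonpos_of_nonneg (hoff i k hk) (hnn k)
  exact (mul_eq_zero.mp ((Finset.sum_eq_zero_iff_of_nonpos hterm).mp hsum j
    (Finset.mem_univ j))).resolve_left hij

/-- Step 1 of the proof of the Perron–Frobenius theorem for real symmetric matrices:
an entrywise nonnegative eigenvector of a connected real symmetric matrix with
nonpositive off-diagonal entries is entrywise strictly positive. -/
theorem nonneg_eigenvector_positive
    (N : ℕ) (hN : 1 ≤ N) (M : Matrix (Fin N) (Fin N) ℝ)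
    (hsym : M.IsSymm)
    (hoff : ∀ i j : Fin N, i ≠ j → M i j ≤ 0)
    (hconn : ∀ i j : Fin N, i ≠ j → ∃ K : ℕ, ∃ c : Fin (K + 1) → Fin N,
      c 0 = i ∧ c (Fin.last K) = j ∧ ∀ k : Fin K, M (c k.castSucc) (c k.succ) ≠ 0)
    (u : Fin N → ℝ) (hu : u ≠ 0) (μ : ℝ)
    (heig : M.mulVec u = μ • u) (hnn : ∀ i, 0 ≤ u i) :
    ∀ i, 0 < u i := by
  intro i
  refine (hnn i).lt_of_ne fun hi => hu (funext fun j => ?_)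
  by_cases hij : i = j
  · simp [← hij, ← hi]
  · obtain ⟨K, c, rfl, rfl, hc⟩ := hconn i j hij
    refine Fin.induction (motive := fun k => u (c k) = 0) hi.symm (fun k hk => ?_) (Fin.last K)
    exact Matrix.eigenvector_apply_eq_zero_of_apply_ne_zero hoff heig hnn hk (hc k)
end

section
/- For any vector ξ : Λ → ℝ and any integer n with 0 ≤ n ≤ |Λ| − 1, define a vector Φ on one-hole configurations by Φ(x,σ) = ξ_x if (x,σ) lies in the n-th magnetization sector and Φ(x,σ) = 0 otherwise. Then (H̃Φ)(y,τ) = −Σ_{x∈Λ} t(x,y) ξ_x if (y,τ) lies in the n-th magnetization sector, and (H̃Φ)(y,τ) = 0 otherwise. Consequently, if ξ is an eigenvector of the Λ×Λ matrix (−t(x,y))_{x,y∈Λ} with eigenvalue ε, then Φ is an eigenvector of H̃ with the same eigenvalue ε. -/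
/-- A one-hole configuration on the lattice `Λ`: the position `x` of the hole together
with a spin configuration on `Λ ∖ {x}` (`true` = ↑, `false` = ↓). -/
abbrev OneHoleConfig (Λ : Type*) := Σ x : Λ, ({z : Λ // z ≠ x} → Bool)

/-- The spin configuration `σ_{y→x}` on `Λ ∖ {y}` obtained from `σ` (a spin configuration
on `Λ ∖ {x}`) by moving the spin at `y` to `x`; when `y = x` this is `σ` itself. -/
def moveSpin {Λ : Type*} [DecidableEq Λ] (x y : Λ) (σ : {z : Λ // z ≠ x} → Bool) :
    {z : Λ // z ≠ y} → Bool :=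
  fun z => if hzx : (z : Λ) = x then σ ⟨y, fun h => z.prop (hzx.trans h.symm)⟩
           else σ ⟨(z : Λ), hzx⟩

/-- The effective one-hole Hamiltonian `H̃` of the `U = ∞`, `N_e = |Λ| - 1` Hubbard model
with hopping amplitudes `t`: the entry `H̃[(y,τ),(x,σ)]` is `-t x y` if `τ = σ_{y→x}`,
and `0` otherwise. -/
def nagaokaHam {Λ : Type*} [Fintype Λ] [DecidableEq Λ] (t : Λ → Λ → ℝ) :
    Matrix (OneHoleConfig Λ) (OneHoleConfig Λ) ℝ :=
  fun c' c => if c'.2 = moveSpin c.1 c'.1 c.2 then -t c.1 c'.1 else 0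

/-- The number of up spins of a one-hole configuration; the `n`-th magnetization sector
consists of the configurations `c` with `upCount c = n`. -/
def upCount {Λ : Type*} [Fintype Λ] [DecidableEq Λ] (c : OneHoleConfig Λ) : ℕ :=
  (Finset.univ.filter fun z : {z : Λ // z ≠ c.1} => c.2 z = true).card

/-- Moving the spin at `y` to `x` and then back restores the spin configuration. -/
theorem moveSpin_moveSpin {Λ : Type*} [DecidableEq Λ] (x y : Λ) (σ : {z : Λ // z ≠ x} → Bool) :
    moveSpin y x (moveSpin x y σ) = σ := by
  funext ⟨z, hz⟩
  by_cases hzy : z = y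
  · subst hzy
    simp [moveSpin]
  · simp [moveSpin, hzy, hz]

theorem eq_moveSpin_iff {Λ : Type*} [DecidableEq Λ] {x y : Λ} {σ : {z : Λ // z ≠ x} → Bool}
    {τ : {z : Λ // z ≠ y} → Bool} : τ = moveSpin x y σ ↔ σ = moveSpin y x τ := by
  constructor <;> rintro rfl <;> rw [moveSpin_moveSpin]

/-- Moving a spin into the hole preserves the magnetization sector. -/
theorem upCount_moveSpin {Λ : Type*} [Fintype Λ] [DecidableEq Λ] (x y : Λ)
    (σ : {z : Λ // z ≠ x} → Bool) :
    upCount (⟨y, moveSpin x y σ⟩ : OneHoleConfig Λ) = upCount ⟨x, σ⟩ := by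
  have e : ∀ z : Λ, z ≠ y ↔ Equiv.swap x y z ≠ x := fun z => by
    rw [Ne, Ne, Equiv.swap_apply_eq_iff, Equiv.swap_apply_left]
  refine Finset.card_equiv ((Equiv.swap x y).subtypeEquiv e) fun ⟨z, hz⟩ => ?_
  by_cases hzx : z = x
  · subst hzx
    simp [moveSpin]
  · simp [moveSpin, hzx, Equiv.swap_apply_of_ne_of_ne hzx hz]

/-- With the hole at any given site, every magnetization sector is inhabited. -/
theorem exists_upCount_eq {Λ : Type*} [Fintype Λ] [DecidableEq Λ] (x : Λ) {n : ℕ}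
    (hn : n ≤ Fintype.card Λ - 1) :
    ∃ σ : {z : Λ // z ≠ x} → Bool, upCount (⟨x, σ⟩ : OneHoleConfig Λ) = n := by
  obtain ⟨s, -, hs⟩ := Finset.exists_subset_card_eq
    (s := (Finset.univ : Finset {z : Λ // z ≠ x})) (n := n) (by simpa using hn)
  exact ⟨fun z => decide (z ∈ s), by simpa [upCount] using hs⟩

/-- The action of `nagaokaHam t` sums over the hole positions reached by a single hop. -/
theorem nagaokaHam_mulVec_apply {Λ : Type*} [Fintype Λ] [DecidableEq Λ] (t : Λ → Λ → ℝ)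
    (Φ : OneHoleConfig Λ → ℝ) (c : OneHoleConfig Λ) :
    (nagaokaHam t).mulVec Φ c = ∑ x : Λ, -t x c.1 * Φ ⟨x, moveSpin c.1 x c.2⟩ := by
  simp [Matrix.mulVec, dotProduct, nagaokaHam, Fintype.sum_sigma, eq_moveSpin_iff (τ := c.2)]

/-- For a vector `ξ : Λ → ℝ` and `n ≤ |Λ| - 1`, the vector `Φ` which equals `ξ x` on the
configurations `(x,σ)` of the `n`-th magnetization sector and `0` elsewhere satisfies
`(H̃Φ)(y,τ) = -∑ x, t x y * ξ x` on the `n`-th sector and `0` elsewhere; consequently if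
`ξ` is an eigenvector of the matrix `(-t x y)` with eigenvalue `ε`, then `Φ` is an
eigenvector of `H̃` with the same eigenvalue `ε`. -/
theorem nagaokaHam_mulVec_sector
    {Λ : Type*} [Fintype Λ] [DecidableEq Λ] (t : Λ → Λ → ℝ)
    (hsym : ∀ x y, t x y = t y x)
    (ξ : Λ → ℝ) (n : ℕ) (hn : n ≤ Fintype.card Λ - 1) :
    ((nagaokaHam t).mulVec (fun c => if upCount c = n then ξ c.1 else 0) =
      fun c' : OneHoleConfig Λ =>
        if upCount c' = n then -(∑ x : Λ, t x c'.1 * ξ x) else 0) ∧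
    (∀ ε : ℝ, ξ ≠ 0 → (Matrix.of fun x y : Λ => -t x y).mulVec ξ = ε • ξ →
      (fun c : OneHoleConfig Λ => if upCount c = n then ξ c.1 else 0) ≠ 0 ∧
      (nagaokaHam t).mulVec (fun c => if upCount c = n then ξ c.1 else 0) =
        ε • fun c : OneHoleConfig Λ => if upCount c = n then ξ c.1 else 0) := by
  have key : (nagaokaHam t).mulVec (fun c => if upCount c = n then ξ c.1 else 0) =
      fun c' : OneHoleConfig Λ =>
        if upCount c' = n then -(∑ x : Λ, t x c'.1 * ξ x) else 0 := by
    funext ⟨y, τ⟩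
    rw [nagaokaHam_mulVec_apply]
    simp only [upCount_moveSpin]
    split_ifs <;> simp
  refine ⟨key, fun ε hξ hε => ⟨fun h => hξ ?_, ?_⟩⟩
  · funext x
    obtain ⟨σ, hσ⟩ := exists_upCount_eq x hn
    simpa [hσ] using congrFun h ⟨x, σ⟩
  · rw [key]
    funext ⟨y, τ⟩
    have hy := congrFun hε y
    simp only [Matrix.mulVec, dotProduct, Matrix.of_apply, Pi.smul_apply, smul_eq_mul, neg_mul,
      Finset.sum_neg_distrib] at hy
    simp only [Pi.smul_apply, smul_eq_mul, mul_ite, mul_zero, ← hy, hsym _ y]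
end

section
/- Let Λ be a finite set and G a simple graph on Λ. Call a pair {x,y} of distinct vertices an exchange bond if x and y both lie on some cycle of G of length 3 or 4, and the subgraph of G induced on Λ∖{x,y} is connected. Define a hole move on one-hole configurations by: (x,σ) → (y, σ_{y→x}) whenever {x,y} is an edge of G. If the graph on the vertex set Λ whose edge set is the set of exchange bonds is connected, then any two one-hole configurations with the same number of up spins can be joined by a finite sequence of hole moves. -/
/-- A cycle of length `m` in the graph `G`: `m` distinct vertices which are cyclically
consecutively adjacent. -/
def IsCycleOn {Λ : Type*} (G : SimpleGraph Λ) (m : ℕ) (c : ZMod m → Λ) : Prop :=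
  Function.Injective c ∧ ∀ i : ZMod m, G.Adj (c i) (c (i + 1))

/-- The pair `{x, y}` of distinct vertices is an *exchange bond* of `G` if `x` and `y`
both lie on some cycle of `G` of length 3 or 4, and the subgraph of `G` induced on
`Λ ∖ {x, y}` is connected. -/
def ExchangeBond {Λ : Type*} (G : SimpleGraph Λ) (x y : Λ) : Prop :=
  x ≠ y ∧
  (∃ m : ℕ, (m = 3 ∨ m = 4) ∧ ∃ c : ZMod m → Λ, IsCycleOn G m c ∧
    x ∈ Set.range c ∧ y ∈ Set.range c) ∧
  (G.induce {z : Λ | z ≠ x ∧ z ≠ y}).Connected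

/-- A hole move: the hole hops from `a.1` to an adjacent site `b.1`, the spin there
moving back to `a.1`. -/
def HoleMove {Λ : Type*} [DecidableEq Λ] (G : SimpleGraph Λ) :
    OneHoleConfig Λ → OneHoleConfig Λ → Prop :=
  fun a b => G.Adj a.1 b.1 ∧ b.2 = moveSpin a.1 b.1 a.2

open Equiv Relation

/-- The three-valued occupation function of a one-hole configuration: `none` at the hole,
the spin elsewhere. -/
def occupation {Λ : Type*} [DecidableEq Λ] (a : OneHoleConfig Λ) : Λ → Option Bool :=
  fun z => if h : z = a.1 then none else some (a.2 ⟨z, h⟩)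

/-- `f` has exactly one hole, located at `h`. -/
def IsHoleAt {Λ : Type*} (f : Λ → Option Bool) (h : Λ) : Prop :=
  ∀ z, f z = none ↔ z = h

/-- A hole move, expressed on occupation functions. -/
def HoleHop {Λ : Type*} [DecidableEq Λ] (G : SimpleGraph Λ) (f g : Λ → Option Bool) : Prop :=
  ∃ x y, G.Adj x y ∧ f x = none ∧ g = f ∘ swap x y

/-- The occupation function obtained from `f` by moving the hole `k` steps along `c`,
starting from `c 0`. -/
def hopAlong {Λ : Type*} [DecidableEq Λ] {m : ℕ} (c : ZMod m → Λ) (f : Λ → Option Bool) :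
    ℕ → Λ → Option Bool
  | 0 => f
  | k + 1 => hopAlong c f k ∘ swap (c k) (c (k + 1))

theorem IsHoleAt.comp_perm {Λ : Type*} {f : Λ → Option Bool} {h : Λ} (hf : IsHoleAt f h)
    (π : Perm Λ) : IsHoleAt (f ∘ π) (π.symm h) := by
  intro z
  rw [Function.comp_apply, hf, eq_symm_apply]

section Occupation

variable {Λ : Type*} [DecidableEq Λ]

theorem isHoleAt_occupation (a : OneHoleConfig Λ) : IsHoleAt (occupation a) a.1 := by
  intro z
  unfold occupation
  split_ifs with h <;> simp [h]

theorem occupation_injective : Function.Injective (occupation (Λ := Λ)) := by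
  rintro ⟨x, σ⟩ ⟨y, τ⟩ h
  obtain rfl : x = y := by
    rw [← isHoleAt_occupation ⟨y, τ⟩ x, ← h]
    exact (isHoleAt_occupation ⟨x, σ⟩ x).2 rfl
  congr 1
  ext ⟨z, hz⟩
  have := congrFun h z
  simpa [occupation, hz] using this

theorem occupation_moveSpin (a : OneHoleConfig Λ) {y : Λ} (hy : a.1 ≠ y) :
    occupation ⟨y, moveSpin a.1 y a.2⟩ = occupation a ∘ swap a.1 y := by
  ext1 z
  by_cases hzy : z = y
  · subst hzy
    simp [occupation]
  by_cases hzx : z = a.1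
  · subst hzx
    simp [occupation, moveSpin, hy, hy.symm]
  · simp [occupation, moveSpin, hzx, hzy, swap_apply_of_ne_of_ne hzx hzy]

theorem reflTransGen_holeMove_of_holeHop {G : SimpleGraph Λ} {a b : OneHoleConfig Λ}
    (h : ReflTransGen (HoleHop G) (occupation a) (occupation b)) :
    ReflTransGen (HoleMove G) a b := by
  suffices ∀ g, ReflTransGen (HoleHop G) (occupation a) g →
      ∃ b, occupation b = g ∧ ReflTransGen (HoleMove G) a b by
    obtain ⟨b', hb', hab⟩ := this _ h
    rwa [← occupation_injective hb']
  intro g hg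
  induction hg with
  | refl => exact ⟨a, rfl, .refl⟩
  | tail _ hop ih =>
    obtain ⟨b, rfl, hab⟩ := ih
    obtain ⟨x, y, hxy, hx, rfl⟩ := hop
    obtain rfl := (isHoleAt_occupation b x).1 hx
    exact ⟨⟨y, moveSpin b.1 y b.2⟩, occupation_moveSpin b hxy.ne, hab.tail ⟨hxy, rfl⟩⟩

end Occupation

section Cycle

variable {Λ : Type*} [DecidableEq Λ] {G : SimpleGraph Λ} {m : ℕ} {c : ZMod m → Λ}

theorem hopAlong_comp (hc : Function.Injective c) (f : Λ → Option Bool) (k : ℕ) :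
    hopAlong c f k ∘ c = hopAlong id (f ∘ c) k := by
  induction k with
  | zero => rfl
  | succ k ih =>
    ext1 i
    simp only [hopAlong, Function.comp_apply, id, ← ih, hc.swap_apply]

theorem hopAlong_of_notMem_range (f : Λ → Option Bool) (k : ℕ) {z : Λ} (hz : z ∉ Set.range c) :
    hopAlong c f k z = f z := by
  induction k with
  | zero => rfl
  | succ k ih =>
    rw [hopAlong, Function.comp_apply, swap_apply_of_ne_of_ne, ih] <;>
      exact fun h => hz ⟨_, h.symm⟩

theorem hopAlong_apply_natCast {f : Λ → Option Bool} (hf : f (c 0) = none) (k : ℕ) :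
    hopAlong c f k (c k) = none := by
  induction k with
  | zero => simpa [hopAlong] using hf
  | succ k ih => simpa [hopAlong] using ih

theorem reflTransGen_hopAlong (hadj : ∀ i, G.Adj (c i) (c (i + 1))) {f : Λ → Option Bool}
    (hf : f (c 0) = none) (k : ℕ) : ReflTransGen (HoleHop G) f (hopAlong c f k) := by
  induction k with
  | zero => exact .refl
  | succ k ih => exact ih.tail ⟨_, _, hadj k, hopAlong_apply_natCast hf k, rfl⟩

theorem exists_hopAlong_eq_comp_swap_three : ∀ g : ZMod 3 → Option Bool,
    (∀ i, g i = none ↔ i = 0) → ∀ i j, ∃ k < 6, hopAlong id g k = g ∘ swap i j := by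
  unfold ZMod
  decide +kernel

theorem exists_hopAlong_eq_comp_swap_four : ∀ g : ZMod 4 → Option Bool,
    (∀ i, g i = none ↔ i = 0) → ∀ i j, ∃ k < 12, hopAlong id g k = g ∘ swap i j := by
  unfold ZMod
  decide +kernel

theorem exists_hopAlong_eq_comp_swap (hm : m = 3 ∨ m = 4) {g : ZMod m → Option Bool}
    (hg : IsHoleAt g 0) (i j : ZMod m) : ∃ k, hopAlong id g k = g ∘ swap i j := by
  rcases hm with rfl | rfl
  · obtain ⟨k, -, hk⟩ := exists_hopAlong_eq_comp_swap_three g hg i j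
    exact ⟨k, hk⟩
  · obtain ⟨k, -, hk⟩ := exists_hopAlong_eq_comp_swap_four g hg i j
    exact ⟨k, hk⟩

/-- On a cycle of length 3 or 4 containing the hole, the contents of any two sites can be
exchanged. -/
theorem IsCycleOn.reflTransGen_comp_swap (hm : m = 3 ∨ m = 4) (hc : IsCycleOn G m c)
    {f : Λ → Option Bool} {l : ZMod m} (hf : IsHoleAt f (c l)) (i j : ZMod m) :
    ReflTransGen (HoleHop G) f (f ∘ swap (c i) (c j)) := by
  wlog hl : l = 0 generalizing c l i j
  · have hc' : IsCycleOn G m (fun i => c (i + l)) :=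
      ⟨hc.1.comp (add_left_injective l), fun i => by
        simpa only [add_right_comm] using hc.2 (i + l)⟩
    simpa using this hc' (l := 0) (by simpa using hf) (i - l) (j - l) rfl
  subst hl
  have hg : IsHoleAt (f ∘ c) 0 := fun i => (hf _).trans hc.1.eq_iff
  obtain ⟨k, hk⟩ := exists_hopAlong_eq_comp_swap hm hg i j
  have key : hopAlong c f k = f ∘ swap (c i) (c j) := by
    ext1 z
    by_cases hz : z ∈ Set.range c
    · obtain ⟨n, rfl⟩ := hz
      have := congrFun ((hopAlong_comp hc.1 f k).trans hk) n
      simpa only [Function.comp_apply, ← hc.1.swap_apply] using this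
    · rw [hopAlong_of_notMem_range f k hz, Function.comp_apply, swap_apply_of_ne_of_ne] <;>
        exact fun h => hz ⟨_, h.symm⟩
  exact key ▸ reflTransGen_hopAlong hc.2 ((hf _).2 rfl) k

end Cycle

section Exchange

variable {Λ : Type*} [DecidableEq Λ] {G : SimpleGraph Λ}

theorem reflTransGen_comp_swap_of_adj {x y h h' : Λ} (hadj : G.Adj h h')
    (hx : h ≠ x) (hy : h ≠ y) (hx' : h' ≠ x) (hy' : h' ≠ y)
    (H : ∀ f, IsHoleAt f h' → ReflTransGen (HoleHop G) f (f ∘ swap x y))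
    {f : Λ → Option Bool} (hf : IsHoleAt f h) :
    ReflTransGen (HoleHop G) f (f ∘ swap x y) := by
  have hg : IsHoleAt (f ∘ swap h h') h' := by simpa using hf.comp_perm (swap h h')
  have hcomm : f ∘ swap x y = ((f ∘ swap h h') ∘ swap x y) ∘ swap h' h := by
    ext1 z
    simp only [Function.comp_apply, swap_apply_def]
    grind
  refine .head ⟨h, h', hadj, (hf _).2 rfl, rfl⟩
    ((H _ hg).tail ⟨h', h, hadj.symm, ?_, hcomm⟩)
  rw [Function.comp_apply, swap_apply_of_ne_of_ne hx' hy', hg]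

theorem exists_ne_ne_of_three_or_four {m : ℕ} (hm : m = 3 ∨ m = 4) (i j : ZMod m) :
    ∃ l, l ≠ i ∧ l ≠ j := by
  rcases hm with rfl | rfl <;> revert i j <;> decide

theorem ExchangeBond.reflTransGen_comp_swap {x y h : Λ} (hxy : ExchangeBond G x y)
    {f : Λ → Option Bool} (hf : IsHoleAt f h) :
    ReflTransGen (HoleHop G) f (f ∘ swap x y) := by
  obtain ⟨-, ⟨m, hm, c, hc, ⟨i, rfl⟩, ⟨j, rfl⟩⟩, hcon⟩ := hxy
  by_cases hh : h ∈ Set.range c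
  · obtain ⟨l, rfl⟩ := hh
    exact hc.reflTransGen_comp_swap hm hf i j
  obtain ⟨l, hli, hlj⟩ := exists_ne_ne_of_three_or_four hm i j
  obtain ⟨w⟩ := hcon.preconnected
    ⟨h, fun e => hh ⟨_, e.symm⟩, fun e => hh ⟨_, e.symm⟩⟩ ⟨c l, hc.1.ne hli, hc.1.ne hlj⟩
  suffices ∀ {u v : {z : Λ | z ≠ c i ∧ z ≠ c j}} (_ : (G.induce _).Walk u v),
      (∀ f, IsHoleAt f v.1 → ReflTransGen (HoleHop G) f (f ∘ swap (c i) (c j))) →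
      ∀ f, IsHoleAt f u.1 → ReflTransGen (HoleHop G) f (f ∘ swap (c i) (c j)) from
    this w (fun f hf => hc.reflTransGen_comp_swap hm hf i j) f hf
  intro u v w H
  induction w with
  | nil => exact H
  | @cons u v _ hadj _ ih =>
    exact fun f => reflTransGen_comp_swap_of_adj (SimpleGraph.induce_adj.1 hadj)
      u.2.1 u.2.2 v.2.1 v.2.2 (ih H)

theorem reflTransGen_comp_swap_of_connected
    (hconn : (SimpleGraph.fromRel (ExchangeBond G)).Connected) (x y : Λ) :
    ∀ (f : Λ → Option Bool) (h : Λ), IsHoleAt f h →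
      ReflTransGen (HoleHop G) f (f ∘ swap x y) := by
  obtain ⟨w⟩ := hconn.preconnected x y
  induction w with
  | nil => intro f h _; rw [swap_self]; exact .refl
  | @cons x z y hxz _ ih =>
    have hbond : ∀ (f : Λ → Option Bool) (h : Λ), IsHoleAt f h →
        ReflTransGen (HoleHop G) f (f ∘ swap x z) := by
      intro f h hf
      rcases (SimpleGraph.fromRel_adj _ _ _).1 hxz with ⟨-, hb | hb⟩
      · exact hb.reflTransGen_comp_swap hf
      · rw [swap_comm]
        exact hb.reflTransGen_comp_swap hf
    intro f h hf
    by_cases hyx : y = x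
    · rw [hyx, swap_self]; exact .refl
    by_cases hyz : y = z
    · rw [hyz]; exact hbond f h hf
    have h₁ := hf.comp_perm (swap x z)
    have h₂ := h₁.comp_perm (swap z y)
    have hconj : f ∘ swap x y = ((f ∘ swap x z) ∘ swap z y) ∘ swap x z := by
      ext1 t
      simp only [Function.comp_apply, swap_apply_def]
      grind [hxz.ne]
    rw [hconj]
    exact ((hbond f h hf).trans (ih _ _ h₁)).trans (hbond _ _ h₂)

theorem reflTransGen_comp_perm_of_connected [Finite Λ]
    (hconn : (SimpleGraph.fromRel (ExchangeBond G)).Connected) (π : Perm Λ) :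
    ∀ (f : Λ → Option Bool) (h : Λ), IsHoleAt f h →
      ReflTransGen (HoleHop G) f (f ∘ π) := by
  induction π using Perm.swap_induction_on with
  | one => exact fun f _ _ => .refl
  | swap_mul π x y _ ih =>
    intro f h hf
    exact (reflTransGen_comp_swap_of_connected hconn x y f h hf).trans
      (ih _ _ (hf.comp_perm (swap x y)))

end Exchange

section Counting

variable {Λ : Type*} [Fintype Λ]

theorem exists_perm_comp_eq_of_card_fiber_eq {β : Type*} [DecidableEq β] {f g : Λ → β}
    (h : ∀ v, Fintype.card {z // f z = v} = Fintype.card {z // g z = v}) :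
    ∃ π : Perm Λ, f ∘ π = g := by
  let e : ∀ v, {z // g z = v} ≃ {z // f z = v} := fun v => (Fintype.equivOfCardEq (h v)).symm
  refine ⟨(sigmaFiberEquiv g).symm.trans ((sigmaCongrRight e).trans (sigmaFiberEquiv f)), ?_⟩
  ext1 z
  exact (e (g z) ⟨z, rfl⟩).2

variable [DecidableEq Λ]

theorem card_occupation_none (a : OneHoleConfig Λ) :
    Fintype.card {z // occupation a z = none} = 1 :=
  Fintype.card_eq_one_iff.2 ⟨⟨a.1, (isHoleAt_occupation a _).2 rfl⟩,
    fun z => Subtype.ext ((isHoleAt_occupation a _).1 z.2)⟩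

theorem card_occupation_some (a : OneHoleConfig Λ) (s : Bool) :
    Fintype.card {z // occupation a z = some s} = Fintype.card {z // a.2 z = s} := by
  have hne : ∀ z, occupation a z = some s → z ≠ a.1 := fun z hz h => by
    simp [(isHoleAt_occupation a z).2 h] at hz
  exact Fintype.card_congr
    { toFun := fun z => ⟨⟨z.1, hne _ z.2⟩, by simpa [occupation, hne _ z.2] using z.2⟩
      invFun := fun z => ⟨z.1.1, by simpa [occupation, z.1.2] using z.2⟩
      left_inv := fun _ => rfl
      right_inv := fun _ => rfl }

theorem card_occupation_some_true (a : OneHoleConfig Λ) :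
    Fintype.card {z // occupation a z = some true} = upCount a := by
  rw [card_occupation_some, Fintype.card_subtype, upCount]

theorem card_occupation_some_false (a : OneHoleConfig Λ) :
    Fintype.card {z // occupation a z = some false} + upCount a + 1 = Fintype.card Λ := by
  rw [← card_occupation_some_true, ← card_occupation_none a,
    ← Fintype.card_congr (sigmaFiberEquiv (occupation a)), Fintype.card_sigma,
    Fintype.sum_option, Fintype.sum_bool]
  ring

theorem exists_perm_occupation_comp_eq {a b : OneHoleConfig Λ} (h : upCount a = upCount b) :
    ∃ π : Perm Λ, occupation a ∘ π = occupation b := by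
  refine exists_perm_comp_eq_of_card_fiber_eq ?_
  rintro (_ | _ | _)
  · rw [card_occupation_none, card_occupation_none]
  · have ha := card_occupation_some_false a
    have hb := card_occupation_some_false b
    omega
  · rw [card_occupation_some_true, card_occupation_some_true, h]

end Counting

/-- **Sufficient condition for the connectivity condition** (Lemma 4.2). If the graph on
`Λ` whose edges are the exchange bonds of `G` is connected, then any two one-hole
configurations with the same number of up spins are joined by a finite sequence of
hole moves. -/
theorem connectivity_of_exchangeBonds
    {Λ : Type*} [Fintype Λ] [DecidableEq Λ] (G : SimpleGraph Λ)
    (hconn : (SimpleGraph.fromRel (ExchangeBond G)).Connected) :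
    ∀ a b : OneHoleConfig Λ, upCount a = upCount b →
      Relation.ReflTransGen (HoleMove G) a b := by
  intro a b hab
  obtain ⟨π, hπ⟩ := exists_perm_occupation_comp_eq hab
  apply reflTransGen_holeMove_of_holeHop
  rw [← hπ]
  exact reflTransGen_comp_perm_of_connected hconn π _ _ (isHoleAt_occupation a)
end

section
/- Let L ≥ 3 be an integer, Λ = ℤ/2Lℤ, and t > 0, λ > 0 real numbers. Define the Λ×Λ matrix T by: T_{x,y} = λt if x − y = ±1; T_{x,y} = t if x and y are both even and x − y = ±2; T_{x,x} = λ²t if x is odd; T_{x,x} = 2t if x is even; and T_{x,y} = 0 otherwise. For each even y ∈ Λ define φ^{(y)} ∈ ℝ^Λ by φ^{(y)}_y = λ, φ^{(y)}_{y−1} = φ^{(y)}_{y+1} = −1, and φ^{(y)}_z = 0 otherwise. Then T is symmetric positive semidefinite, Tφ^{(y)} = 0 for every even y, the L vectors {φ^{(y)} : y even} are linearly independent and span the kernel of T; in particular 0 is the lowest eigenvalue of T and its multiplicity is exactly L. -/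
/-- The hopping matrix of the one-dimensional flat-band (delta-chain / decorated chain)
model on `ℤ/2Lℤ`: `λt` between nearest neighbours, `t` between even (external) sites at
distance 2, on-site energy `λ²t` at odd (internal) sites and `2t` at even sites. -/
def deltaChainHopping (L : ℕ) [NeZero (2 * L)] (t lam : ℝ) :
    Matrix (ZMod (2 * L)) (ZMod (2 * L)) ℝ :=
  fun x y =>
    if x = y then (if x.val % 2 = 1 then lam ^ 2 * t else 2 * t)
    else if y = x + 1 ∨ y = x - 1 then lam * t
    else if x.val % 2 = 0 ∧ y.val % 2 = 0 ∧ (y = x + 2 ∨ y = x - 2) then t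
    else 0

/-- The localized state `φ^{(y)}` (for an even site `y`): value `λ` at `y`, `-1` at the
two neighbouring internal sites `y ± 1`, and `0` elsewhere. -/
def deltaChainLocState (L : ℕ) [NeZero (2 * L)] (lam : ℝ)
    (y : {y : ZMod (2 * L) // y.val % 2 = 0}) : ZMod (2 * L) → ℝ :=
  fun z => if z = (y : ZMod (2 * L)) then lam
           else if z = (y : ZMod (2 * L)) + 1 ∨ z = (y : ZMod (2 * L)) - 1 then -1
           else 0

theorem ZMod.val_add_one_mod_two {L : ℕ} [NeZero (2 * L)] (x : ZMod (2 * L)) :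
    (x + 1).val % 2 = (x.val + 1) % 2 := by
  rw [ZMod.val_add, Nat.mod_mod_of_dvd _ (Dvd.intro _ rfl), ZMod.val_one'' (by omega)]

theorem ZMod.val_sub_one_mod_two {L : ℕ} [NeZero (2 * L)] (x : ZMod (2 * L)) :
    (x - 1).val % 2 = (x.val + 1) % 2 := by
  have h := ZMod.val_add_one_mod_two (x - 1)
  rw [sub_add_cancel] at h
  omega

theorem ZMod.natCast_ne_zero_of_lt {n k : ℕ} (hk : 0 < k) (hkn : k < n) : (k : ZMod n) ≠ 0 := by
  rw [Ne, ZMod.natCast_eq_zero_iff]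
  exact Nat.not_dvd_of_pos_of_lt hk hkn

/-- The even residues modulo `2 * L` are counted by `L`. -/
theorem ZMod.card_even_val (L : ℕ) [NeZero (2 * L)] :
    Fintype.card {y : ZMod (2 * L) // y.val % 2 = 0} = L := by
  have hval (i : Fin L) : ((2 * i : ℕ) : ZMod (2 * L)).val = 2 * i :=
    ZMod.val_cast_of_lt (by omega)
  let f : Fin L → {y : ZMod (2 * L) // y.val % 2 = 0} :=
    fun i => ⟨((2 * i : ℕ) : ZMod (2 * L)), by rw [hval]; omega⟩
  have hf : Function.Bijective f := by
    refine ⟨fun i j hij => ?_, fun y => ?_⟩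
    · have h := congrArg (fun z => z.1.val) hij
      simp only [f, hval] at h
      omega
    · have hy := y.2
      have hlt := ZMod.val_lt y.1
      refine ⟨⟨y.1.val / 2, by omega⟩, Subtype.ext (ZMod.val_injective _ ?_)⟩
      simp only [f]
      rw [ZMod.val_cast_of_lt] <;> omega
  simpa using (Fintype.card_of_bijective hf).symm

/-- The matrix whose row at an odd site `j` is `lam` at `j` and `1` at `j ± 1`; the rows at
even sites vanish. -/
def deltaChainFactor (L : ℕ) [NeZero (2 * L)] (lam : ℝ) :
    Matrix (ZMod (2 * L)) (ZMod (2 * L)) ℝ :=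
  fun j x => if j.val % 2 = 1 then
    (if x = j then lam else 0) + (if x = j + 1 then 1 else 0) + (if x = j - 1 then 1 else 0)
    else 0

theorem deltaChainFactor_mulVec (L : ℕ) [NeZero (2 * L)] (lam : ℝ) (v : ZMod (2 * L) → ℝ)
    (j : ZMod (2 * L)) :
    (deltaChainFactor L lam).mulVec v j =
      if j.val % 2 = 1 then lam * v j + v (j + 1) + v (j - 1) else 0 := by
  simp only [Matrix.mulVec, dotProduct, deltaChainFactor]
  split_ifs <;> simp [add_mul, Finset.sum_add_distrib]

/-- The columns of `deltaChainFactor`, read as functions of the row index. -/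
theorem deltaChainFactor_apply_eq (L : ℕ) [NeZero (2 * L)] (lam : ℝ) (j x : ZMod (2 * L)) :
    deltaChainFactor L lam j x =
      if x.val % 2 = 1 then (if j = x then lam else 0)
      else (if j = x + 1 then 1 else 0) + (if j = x - 1 then 1 else 0) := by
  have h₁ := ZMod.val_add_one_mod_two x
  have h₂ := ZMod.val_sub_one_mod_two x
  have e₁ : x = j + 1 ↔ j = x - 1 := by grind
  have e₂ : x = j - 1 ↔ j = x + 1 := by grind
  have e₃ : x = j ↔ j = x := eq_comm
  simp only [deltaChainFactor, e₁, e₂, e₃]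
  grind

theorem deltaChainHopping_eq (L : ℕ) [NeZero (2 * L)] (hL : 3 ≤ L) (t lam : ℝ) :
    deltaChainHopping L t lam =
      t • ((deltaChainFactor L lam).conjTranspose * deltaChainFactor L lam) := by
  ext x y
  have n₂ : (2 : ZMod (2 * L)) ≠ 0 := by
    exact_mod_cast ZMod.natCast_ne_zero_of_lt (n := 2 * L) (k := 2) (by omega) (by omega)
  have n₄ : (4 : ZMod (2 * L)) ≠ 0 := by
    exact_mod_cast ZMod.natCast_ne_zero_of_lt (n := 2 * L) (k := 4) (by omega) (by omega)
  have d₁ : x + 1 ≠ x - 1 := fun h => n₂ (by linear_combination h)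
  have d₂ : x ≠ x + 2 := fun h => n₂ (by linear_combination -h)
  have d₃ : x ≠ x - 2 := fun h => n₂ (by linear_combination h)
  have d₄ : x + 2 ≠ x - 2 := fun h => n₄ (by linear_combination h)
  have h₁ := ZMod.val_add_one_mod_two x
  have h₂ := ZMod.val_sub_one_mod_two x
  have hsum : ((deltaChainFactor L lam).conjTranspose * deltaChainFactor L lam) x y =
      if x.val % 2 = 1 then lam * deltaChainFactor L lam x y
      else deltaChainFactor L lam (x + 1) y + deltaChainFactor L lam (x - 1) y := by
    simp only [Matrix.mul_apply, Matrix.conjTranspose_apply, star_trivial,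
      deltaChainFactor_apply_eq L lam _ x]
    split_ifs <;> simp [add_mul, Finset.sum_add_distrib]
  rw [Matrix.smul_apply, hsum, smul_eq_mul]
  have a₁ : x + 1 + 1 = x + 2 := by ring
  have a₂ : x - 1 - 1 = x - 2 := by ring
  rcases Nat.mod_two_eq_zero_or_one x.val with hx | hx
  · have h₁' : (x + 1).val % 2 = 1 := by omega
    have h₂' : (x - 1).val % 2 = 1 := by omega
    have g₁ := ZMod.val_add_one_mod_two (x + 1)
    have g₂ := ZMod.val_sub_one_mod_two (x - 1)
    rw [a₁] at g₁
    rw [a₂] at g₂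
    simp only [deltaChainHopping, deltaChainFactor, hx, h₁', h₂', a₁, a₂, add_sub_cancel_right,
      sub_add_cancel]
    grind
  · simp only [deltaChainHopping, deltaChainFactor, hx]
    grind

theorem deltaChainHopping_ker (L : ℕ) [NeZero (2 * L)] (hL : 3 ≤ L) {t : ℝ} (ht : t ≠ 0)
    (lam : ℝ) :
    LinearMap.ker (deltaChainHopping L t lam).mulVecLin =
      LinearMap.ker (deltaChainFactor L lam).mulVecLin := by
  rw [deltaChainHopping_eq L hL,
    ← Matrix.ker_mulVecLin_conjTranspose_mul_self (deltaChainFactor L lam)]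
  ext v
  rw [LinearMap.mem_ker, LinearMap.mem_ker, Matrix.mulVecLin_apply, Matrix.mulVecLin_apply,
    Matrix.smul_mulVec, smul_eq_zero_iff_right ht]

theorem deltaChainLocState_apply_even (L : ℕ) [NeZero (2 * L)] (lam : ℝ)
    (y z : {y : ZMod (2 * L) // y.val % 2 = 0}) :
    deltaChainLocState L lam y z = if y = z then lam else 0 := by
  have h₁ := ZMod.val_add_one_mod_two y.1
  have h₂ := ZMod.val_sub_one_mod_two y.1
  have hy := y.2
  have hz := z.2
  simp only [deltaChainLocState, Subtype.ext_iff]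
  grind

theorem deltaChainLocState_mem_ker (L : ℕ) [NeZero (2 * L)] (hL : 3 ≤ L) (lam : ℝ)
    (y : {y : ZMod (2 * L) // y.val % 2 = 0}) :
    deltaChainLocState L lam y ∈ LinearMap.ker (deltaChainFactor L lam).mulVecLin := by
  have n₂ : (2 : ZMod (2 * L)) ≠ 0 := by
    exact_mod_cast ZMod.natCast_ne_zero_of_lt (n := 2 * L) (k := 2) (by omega) (by omega)
  rw [LinearMap.mem_ker, Matrix.mulVecLin_apply]
  ext j
  rw [deltaChainFactor_mulVec, Pi.zero_apply]
  split_ifs with hj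
  · have h₁ := ZMod.val_add_one_mod_two j
    have h₂ := ZMod.val_sub_one_mod_two j
    have h₃ : (j + 1).val % 2 = 0 := by omega
    have h₄ : (j - 1).val % 2 = 0 := by omega
    have e₁ := deltaChainLocState_apply_even L lam y ⟨j + 1, h₃⟩
    have e₂ := deltaChainLocState_apply_even L lam y ⟨j - 1, h₄⟩
    have hy := y.2
    simp only [Subtype.ext_iff] at e₁ e₂
    rw [e₁, e₂, deltaChainLocState]
    grind
  · rfl

theorem eq_zero_of_mem_ker_deltaChainFactor {L : ℕ} [NeZero (2 * L)] {lam : ℝ} (hlam : lam ≠ 0)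
    {v : ZMod (2 * L) → ℝ} (hv : v ∈ LinearMap.ker (deltaChainFactor L lam).mulVecLin)
    (heven : ∀ z, z.val % 2 = 0 → v z = 0) : v = 0 := by
  ext j
  rcases Nat.mod_two_eq_zero_or_one j.val with hj | hj
  · exact heven j hj
  · have h := congrFun (LinearMap.mem_ker.mp hv) j
    have h₁ := ZMod.val_add_one_mod_two j
    have h₂ := ZMod.val_sub_one_mod_two j
    rw [Matrix.mulVecLin_apply, deltaChainFactor_mulVec, if_pos hj, heven (j + 1) (by omega),
      heven (j - 1) (by omega)] at h
    simpa [hlam] using h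

theorem sum_smul_deltaChainLocState_apply_even (L : ℕ) [NeZero (2 * L)] (lam : ℝ)
    (c : {y : ZMod (2 * L) // y.val % 2 = 0} → ℝ) (z : {y : ZMod (2 * L) // y.val % 2 = 0}) :
    (∑ y, c y • deltaChainLocState L lam y) z.1 = c z * lam := by
  simp [Finset.sum_apply, deltaChainLocState_apply_even]

theorem deltaChainLocState_linearIndependent (L : ℕ) [NeZero (2 * L)] {lam : ℝ}
    (hlam : lam ≠ 0) : LinearIndependent ℝ (deltaChainLocState L lam) := by
  rw [Fintype.linearIndependent_iff]
  intro c hc z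
  have h := sum_smul_deltaChainLocState_apply_even L lam c z
  rw [hc] at h
  simpa [hlam] using h.symm

theorem span_deltaChainLocState (L : ℕ) [NeZero (2 * L)] (hL : 3 ≤ L) {lam : ℝ}
    (hlam : lam ≠ 0) :
    Submodule.span ℝ (Set.range (deltaChainLocState L lam)) =
      LinearMap.ker (deltaChainFactor L lam).mulVecLin := by
  apply le_antisymm
  · rw [Submodule.span_le]
    rintro _ ⟨y, rfl⟩
    exact deltaChainLocState_mem_ker L hL lam y
  · intro v hv
    have hker := Submodule.sum_mem _ fun y (_ : y ∈ Finset.univ) =>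
      Submodule.smul_mem _ (v y.1 / lam) (deltaChainLocState_mem_ker L hL lam y)
    have h := eq_zero_of_mem_ker_deltaChainFactor hlam (Submodule.sub_mem _ hv hker)
      fun z hz => by
        rw [Pi.sub_apply,
          sum_smul_deltaChainLocState_apply_even L lam (fun y => v y.1 / lam) ⟨z, hz⟩,
          div_mul_cancel₀ _ hlam, sub_self]
    rw [sub_eq_zero.mp h]
    exact Submodule.sum_mem _ fun y _ =>
      Submodule.smul_mem _ _ (Submodule.subset_span ⟨y, rfl⟩)

/-- Single-electron problem of the one-dimensional flat-band Hubbard model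
(Section 6.2-6.3, `d = 1`): the hopping matrix `T` is symmetric positive semidefinite,
the `L` localized states `φ^{(y)}` (`y` even) are zero-energy states, are linearly
independent, and span the kernel of `T`; in particular `0` is the lowest eigenvalue of
`T` and its multiplicity is exactly `L`. -/
theorem deltaChain_flatBand
    (L : ℕ) [NeZero (2 * L)] (hL : 3 ≤ L) (t lam : ℝ) (ht : 0 < t) (hlam : 0 < lam) :
    (deltaChainHopping L t lam).IsSymm ∧
    (deltaChainHopping L t lam).PosSemidef ∧
    (∀ y : {y : ZMod (2 * L) // y.val % 2 = 0},
      (deltaChainHopping L t lam).mulVec (deltaChainLocState L lam y) = 0) ∧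
    LinearIndependent ℝ (deltaChainLocState L lam) ∧
    Submodule.span ℝ (Set.range (deltaChainLocState L lam)) =
      LinearMap.ker (deltaChainHopping L t lam).mulVecLin ∧
    Module.finrank ℝ (LinearMap.ker (deltaChainHopping L t lam).mulVecLin) = L := by
  have hspan := span_deltaChainLocState L hL hlam.ne'
  have hker := deltaChainHopping_ker L hL ht.ne' lam
  have hli := deltaChainLocState_linearIndependent L hlam.ne'
  have hpos : (deltaChainHopping L t lam).PosSemidef := by
    rw [deltaChainHopping_eq L hL]
    exact (Matrix.posSemidef_conjTranspose_mul_self _).smul ht.le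
  refine ⟨?_, hpos, fun y => ?_, hli, hspan.trans hker.symm, ?_⟩
  · rw [Matrix.IsSymm, ← Matrix.conjTranspose_eq_transpose_of_trivial]
    exact hpos.isHermitian
  · have hy := deltaChainLocState_mem_ker L hL lam y
    rwa [← hker, LinearMap.mem_ker, Matrix.mulVecLin_apply] at hy
  · rw [hker, ← hspan, finrank_span_eq_card hli, ZMod.card_even_val]
end

section
/- Let t > 0 and λ > 0 be real numbers, and set t' = λt and V = (λ² − 2)t. Then for every k ∈ ℝ, the eigenvalues of the real symmetric 2×2 matrix A(k) = [[2t·cos k, 2t'·cos(k/2)], [2t'·cos(k/2), V]] are exactly −2t and λ²t + 2t·cos k, and −2t is the smaller of the two. In particular the lower eigenvalue branch is independent of k (the lowest band is flat). -/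
/-- A real number is an eigenvalue of a matrix iff it is a root of `det (M - μ)`. -/
theorem Matrix.exists_mulVec_eq_smul_iff_det_sub_eq_zero {n : Type*} [Fintype n] [DecidableEq n]
    (M : Matrix n n ℝ) (μ : ℝ) :
    (∃ v : n → ℝ, v ≠ 0 ∧ M.mulVec v = μ • v) ↔ (M - μ • (1 : Matrix n n ℝ)).det = 0 := by
  rw [← Matrix.exists_mulVec_eq_zero_iff]
  simp only [Matrix.sub_mulVec, Matrix.smul_mulVec, Matrix.one_mulVec, sub_eq_zero]

/-- The flat-band case of the two-band chain of Appendix E: for `t' = λt` and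
`V = (λ² - 2)t` (with `t, λ > 0`), the eigenvalues of the Bloch Hamiltonian `A(k)` are
exactly `-2t` and `λ²t + 2t cos k`, and `-2t` is the smaller of the two; in particular
the lower band is flat (independent of `k`). -/
theorem twoBandChain_flatBand_eigenvalues (t lam : ℝ) (ht : 0 < t) (hlam : 0 < lam)
    (k : ℝ) :
    (∀ μ : ℝ,
      (∃ v : Fin 2 → ℝ, v ≠ 0 ∧
        (!![2 * t * Real.cos k, 2 * (lam * t) * Real.cos (k / 2);
            2 * (lam * t) * Real.cos (k / 2), (lam ^ 2 - 2) * t]).mulVec v = μ • v) ↔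
      (μ = -(2 * t) ∨ μ = lam ^ 2 * t + 2 * t * Real.cos k)) ∧
    -(2 * t) ≤ lam ^ 2 * t + 2 * t * Real.cos k := by
  have hcos : Real.cos k = 2 * Real.cos (k / 2) ^ 2 - 1 := by
    rw [← Real.cos_two_mul, mul_div_cancel₀ k two_ne_zero]
  refine ⟨fun μ => ?_, ?_⟩
  · rw [Matrix.exists_mulVec_eq_smul_iff_det_sub_eq_zero, ← sub_eq_zero (a := μ),
      ← sub_eq_zero (a := μ) (b := lam ^ 2 * t + 2 * t * Real.cos k), ← mul_eq_zero]
    refine Eq.congr_left ?_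
    simp [Matrix.det_fin_two, hcos]
    ring
  · nlinarith [Real.neg_one_le_cos k, mul_pos (pow_pos hlam 2) ht]
end

section
/- Let N_s ≥ 3 and let N_e be odd with 1 ≤ N_e ≤ N_s; let t > 0 and J > 0. For each n ∈ {0,...,N_e}, the restriction of the U = ∞ ferromagnetic t–J chain Hamiltonian H to the n-th magnetization sector has a simple smallest eigenvalue E_n (its lowest eigenspace is one-dimensional), and these values coincide: E_0 = E_1 = ... = E_{N_e}. In particular the ground-state eigenspace of H has dimension exactly N_e + 1, with exactly one ground state in each magnetization sector. (This is Theorem 7.1: the ground states of the one-dimensional ferromagnetic t–J model at U = ∞ have total spin S_max = N_e/2 and are nondegenerate apart from the trivial (2S_max+1)-fold degeneracy.) -/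
/-- A configuration of the chain `ℤ/N_sℤ`: each site is empty (`none`), or carries an
up spin (`some true`) or a down spin (`some false`). -/
abbrev ChainCfg (Ns : ℕ) := ZMod Ns → Option Bool

/-- The number of occupied sites of a configuration. -/
def occNum {Ns : ℕ} [NeZero Ns] (ω : ChainCfg Ns) : ℕ :=
  (Finset.univ.filter fun x : ZMod Ns => ω x ≠ none).card

/-- The number of up spins of a configuration. -/
def upNum {Ns : ℕ} [NeZero Ns] (ω : ChainCfg Ns) : ℕ :=
  (Finset.univ.filter fun x : ZMod Ns => ω x = some true).card

/-- `ω'` is obtained from `ω` by moving the spin at some site to an empty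
cyclically-nearest-neighbour site. -/
def NNHop {Ns : ℕ} (ω ω' : ChainCfg Ns) : Prop :=
  ∃ x : ZMod Ns,
    (ω x ≠ none ∧ ω (x + 1) = none ∧
      ω' = Function.update (Function.update ω x none) (x + 1) (ω x)) ∨
    (ω (x + 1) ≠ none ∧ ω x = none ∧
      ω' = Function.update (Function.update ω (x + 1) none) x (ω (x + 1)))

/-- `ω'` is obtained from `ω` by interchanging opposite spins (one ↑, one ↓) on two
cyclically-nearest-neighbour sites. -/
def SpinExch {Ns : ℕ} (ω ω' : ChainCfg Ns) : Prop :=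
  ∃ x : ZMod Ns,
    ((ω x = some true ∧ ω (x + 1) = some false) ∨
      (ω x = some false ∧ ω (x + 1) = some true)) ∧
    ω' = Function.update (Function.update ω x (ω (x + 1))) (x + 1) (ω x)

/-- The number of cyclically-nearest-neighbour pairs carrying opposite spins. -/
def antiparallelCount {Ns : ℕ} [NeZero Ns] (ω : ChainCfg Ns) : ℕ :=
  (Finset.univ.filter fun x : ZMod Ns =>
    (ω x = some true ∧ ω (x + 1) = some false) ∨
      (ω x = some false ∧ ω (x + 1) = some true)).card

/-- Hard-core configurations with exactly `Ne` electrons. -/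
abbrev HardCoreCfg (Ns Ne : ℕ) [NeZero Ns] := {ω : ChainCfg Ns // occNum ω = Ne}

open Classical in
/-- The `U = ∞` ferromagnetic `t`-`J` chain Hamiltonian, written in the ordered
position–spin basis of the no-double-occupancy subspace: entry `-t` for
nearest-neighbour hops of a spin into an empty site, `-J/2` for nearest-neighbour
exchange of opposite spins, and diagonal entry `(J/2) ·` (number of antiparallel
nearest-neighbour pairs). -/
noncomputable def tJHam (Ns Ne : ℕ) [NeZero Ns] (t J : ℝ) :
    Matrix (HardCoreCfg Ns Ne) (HardCoreCfg Ns Ne) ℝ :=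
  fun ω' ω =>
    if NNHop ω.1 ω'.1 then -t
    else if SpinExch ω.1 ω'.1 then -(J / 2)
    else if ω' = ω then (J / 2) * (antiparallelCount ω.1 : ℝ)
    else 0

section PerronFrobenius

open Matrix Relation

variable {ι : Type*} [Fintype ι]

/-- Zeros of a nonnegative vector propagate along negative entries of a matrix with nonpositive
off-diagonal entries. -/
theorem eq_zero_of_mulVec_nonneg {A : Matrix ι ι ℝ} (hA : ∀ i j, i ≠ j → A i j ≤ 0)
    {u : ι → ℝ} (hu : ∀ i, 0 ≤ u i) {i j : ι} (hi : u i = 0) (h : 0 ≤ (A *ᵥ u) i)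
    (hij : A i j < 0) : u j = 0 := by
  have hterm : ∀ k ∈ Finset.univ, A i k * u k ≤ 0 := by
    intro k _
    by_cases hk : i = k
    · subst hk; simp [hi]
    · exact mul_nonpos_of_nonpos_of_nonneg (hA i k hk) (hu k)
  have hsum : ∑ k, A i k * u k = 0 := le_antisymm (Finset.sum_nonpos hterm) h
  have := (Finset.sum_eq_zero_iff_of_nonpos hterm).1 hsum j (Finset.mem_univ j)
  exact (mul_eq_zero.1 this).resolve_left hij.ne

/-- Zeros of a nonnegative eigenvector propagate along chains of negative entries. -/
theorem eq_zero_of_reflTransGen {A : Matrix ι ι ℝ} (hA : ∀ i j, i ≠ j → A i j ≤ 0)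
    {u : ι → ℝ} (hu : ∀ i, 0 ≤ u i) {E : ℝ} (hE : A *ᵥ u = E • u) {i j : ι} (hi : u i = 0)
    (hij : ReflTransGen (fun a b => A a b < 0) i j) : u j = 0 := by
  induction hij with
  | refl => exact hi
  | tail _ hbc ih => exact eq_zero_of_mulVec_nonneg hA hu ih (by simp [hE, ih]) hbc

/-- A real quadratic form attains its minimum on the unit sphere. -/
theorem exists_forall_mul_dotProduct_le [Nonempty ι] (A : Matrix ι ι ℝ) :
    ∃ (E : ℝ) (v : ι → ℝ), v ≠ 0 ∧ v ⬝ᵥ A *ᵥ v = E * (v ⬝ᵥ v) ∧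
      ∀ x : ι → ℝ, E * (x ⬝ᵥ x) ≤ x ⬝ᵥ A *ᵥ x := by
  classical
  set K : Set (ι → ℝ) := {x | x ⬝ᵥ x = 1} with hK
  have hKc : IsCompact K := by
    refine Metric.isCompact_of_isClosed_isBounded
      (isClosed_eq (by simp only [dotProduct]; fun_prop) continuous_const) ?_
    refine (Metric.isBounded_closedBall (x := (0 : ι → ℝ)) (r := 1)).subset fun x hx => ?_
    rw [mem_closedBall_zero_iff, pi_norm_le_iff_of_nonneg zero_le_one]
    intro i
    rw [Real.norm_eq_abs, ← sq_le_one_iff_abs_le_one]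
    have hx' : ∑ k, x k * x k = 1 := hx
    rw [← hx', sq]
    exact Finset.single_le_sum (f := fun k => x k * x k) (fun k _ => mul_self_nonneg _)
      (Finset.mem_univ i)
  have hKne : K.Nonempty := by
    obtain ⟨i⟩ := ‹Nonempty ι›
    exact ⟨Pi.single i 1, by simp [hK]⟩
  obtain ⟨v, hv, hmin⟩ := hKc.exists_isMinOn hKne
    (f := fun x => x ⬝ᵥ A *ᵥ x)
    (Continuous.continuousOn (by simp only [dotProduct, mulVec]; fun_prop))
  have hv1 : v ⬝ᵥ v = 1 := hv
  refine ⟨v ⬝ᵥ A *ᵥ v, v, ?_, by rw [hv1, mul_one], fun x => ?_⟩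
  · rintro rfl
    simp at hv1
  by_cases hx : x = 0
  · simp [hx]
  have hpos : 0 < x ⬝ᵥ x := by
    obtain ⟨i, hi⟩ := Function.ne_iff.1 hx
    exact Finset.sum_pos' (fun k _ => mul_self_nonneg _)
      ⟨i, Finset.mem_univ i, mul_self_pos.2 hi⟩
  set r := Real.sqrt (x ⬝ᵥ x) with hr
  have hr2 : r * r = x ⬝ᵥ x := Real.mul_self_sqrt hpos.le
  have hr0 : 0 < r := Real.sqrt_pos.2 hpos
  have hmem : r⁻¹ • x ∈ K := by
    simp only [hK, Set.mem_ofPred_eq, smul_dotProduct, dotProduct_smul, smul_eq_mul, ← hr2]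
    field_simp
  have hle : v ⬝ᵥ A *ᵥ v ≤ (r⁻¹ • x) ⬝ᵥ A *ᵥ (r⁻¹ • x) := hmin hmem
  simp only [mulVec_smul, smul_dotProduct, dotProduct_smul, smul_eq_mul] at hle
  rw [← hr2]
  calc v ⬝ᵥ A *ᵥ v * (r * r) ≤ (r⁻¹ * (r⁻¹ * x ⬝ᵥ A *ᵥ x)) * (r * r) :=
        mul_le_mul_of_nonneg_right hle (by positivity)
    _ = x ⬝ᵥ A *ᵥ x := by field_simp

/-- **Perron–Frobenius, existence**: an irreducible real symmetric matrix with nonpositive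
off-diagonal entries has a positive eigenvector. -/
theorem exists_pos_eigenvector [Nonempty ι] {A : Matrix ι ι ℝ} (hsymm : A.IsSymm)
    (hA : ∀ i j, i ≠ j → A i j ≤ 0)
    (hconn : ∀ i j, ReflTransGen (fun a b => A a b < 0) i j) :
    ∃ (E : ℝ) (v : ι → ℝ), (∀ i, 0 < v i) ∧ A *ᵥ v = E • v := by
  classical
  obtain ⟨E, v, hv0, hvE, hmin⟩ := exists_forall_mul_dotProduct_le A
  set u : ι → ℝ := fun i => |v i| with hu
  have hsub : ∀ x : ι → ℝ, x ⬝ᵥ (A - E • (1 : Matrix ι ι ℝ)) *ᵥ x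
      = x ⬝ᵥ A *ᵥ x - E * (x ⬝ᵥ x) := by
    intro x
    simp [sub_mulVec, smul_mulVec]
  have hpsd : (A - E • (1 : Matrix ι ι ℝ)).PosSemidef := by
    refine PosSemidef.of_dotProduct_mulVec_nonneg ?_ fun x => ?_
    · ext i j
      simp [conjTranspose_apply, hsymm.apply, one_apply, eq_comm]
    · rw [star_trivial, hsub]
      linarith [hmin x]
  have huu : u ⬝ᵥ u = v ⬝ᵥ v := by simp [dotProduct, hu]
  have hle : u ⬝ᵥ A *ᵥ u ≤ v ⬝ᵥ A *ᵥ v := by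
    simp only [dotProduct, mulVec, Finset.mul_sum]
    refine Finset.sum_le_sum fun i _ => Finset.sum_le_sum fun j _ => ?_
    by_cases hij : i = j
    · subst hij
      have := abs_mul_abs_self (v i)
      apply le_of_eq
      simp only [hu]
      linear_combination A i i * this
    · have h1 : v i * v j ≤ u i * u j := by
        simp only [hu, ← abs_mul]; exact le_abs_self _
      nlinarith [mul_le_mul_of_nonpos_left h1 (hA i j hij)]
  have hzero : (A - E • (1 : Matrix ι ι ℝ)) *ᵥ u = 0 := by
    rw [← hpsd.dotProduct_mulVec_zero_iff, star_trivial, hsub, huu]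
    refine le_antisymm (by linarith) ?_
    have := hmin u
    rw [huu] at this
    linarith
  have huE : A *ᵥ u = E • u := by
    simpa [sub_mulVec, smul_mulVec, sub_eq_zero] using hzero
  have hu0 : ∀ i, 0 ≤ u i := fun i => abs_nonneg _
  refine ⟨E, u, fun i => lt_of_le_of_ne (hu0 i) fun hi => hv0 ?_, huE⟩
  ext j
  exact abs_eq_zero.1 (eq_zero_of_reflTransGen hA hu0 huE hi.symm (hconn i j))

/-- **Perron–Frobenius, minimality and simplicity**: on a connected block `S` of a matrix with
nonpositive off-diagonal entries, an eigenvector positive on `S` has the smallest eigenvalue, and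
this eigenvalue is simple. -/
theorem pos_eigenvector_minimal {A : Matrix ι ι ℝ} (hA : ∀ i j, i ≠ j → A i j ≤ 0) {S : Set ι}
    (hconn : ∀ i ∈ S, ∀ j ∈ S, ReflTransGen (fun a b => A a b < 0) i j)
    {v w : ι → ℝ} (hvpos : ∀ i ∈ S, 0 < v i) (hv0 : ∀ i ∉ S, v i = 0) (hw0 : ∀ i ∉ S, w i = 0)
    {E μ : ℝ} (hv : A *ᵥ v = E • v) (hw : A *ᵥ w = μ • w) (hne : w ≠ 0) :
    E ≤ μ ∧ (μ = E → ∃ c : ℝ, w = c • v) := by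
  classical
  wlog hpos : ∃ i, 0 < w i generalizing w
  · have hneg : ∃ i, 0 < (-w) i := by
      obtain ⟨i, hi⟩ := Function.ne_iff.1 hne
      push Not at hpos
      exact ⟨i, by simpa using lt_of_le_of_ne (hpos i) hi⟩
    obtain ⟨h1, h2⟩ := this (w := -w) (by simpa using hw0) (by rw [mulVec_neg, hw, smul_neg])
      (neg_ne_zero.2 hne) hneg
    refine ⟨h1, fun h => ?_⟩
    obtain ⟨c, hc⟩ := h2 h
    exact ⟨-c, by rw [neg_smul, ← hc, neg_neg]⟩
  obtain ⟨k, hk⟩ := hpos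
  have hkS : k ∈ S := by
    by_contra h
    exact hk.ne' (hw0 k h)
  obtain ⟨i, hi, hmax⟩ := Finset.exists_max_image (Finset.univ.filter (· ∈ S))
    (fun j => w j / v j) ⟨k, by simpa using hkS⟩
  have hiS : i ∈ S := by simpa using hi
  set c := w i / v i with hc
  have hcpos : 0 < c := (div_pos hk (hvpos k hkS)).trans_le (hmax k (by simpa using hkS))
  have hwi : w i = c * v i := by rw [hc, div_mul_cancel₀ _ (hvpos i hiS).ne']
  set u : ι → ℝ := c • v - w with hu
  have hu0 : ∀ j, 0 ≤ u j := by
    intro j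
    by_cases hj : j ∈ S
    · have := (div_le_iff₀ (hvpos j hj)).1 (hmax j (by simpa using hj))
      simpa [hu] using this
    · simp [hu, hv0 j hj, hw0 j hj]
  have hui : u i = 0 := by simp [hu, hwi]
  have hAu : A *ᵥ u = c • E • v - μ • w := by rw [hu, mulVec_sub, mulVec_smul, hv, hw]
  constructor
  · by_contra! hlt
    have h1 : (A *ᵥ u) i = (E - μ) * w i := by
      rw [hAu]; simp only [Pi.sub_apply, Pi.smul_apply, smul_eq_mul, hwi]; ring
    have h2 : (A *ᵥ u) i ≤ 0 := by
      refine Finset.sum_nonpos fun j _ => ?_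
      by_cases hj : i = j
      · subst hj; simp [hui]
      · exact mul_nonpos_of_nonpos_of_nonneg (hA i j hj) (hu0 j)
    have h3 : 0 < (E - μ) * w i :=
      mul_pos (sub_pos.2 hlt) (hwi ▸ mul_pos hcpos (hvpos i hiS))
    linarith
  · rintro rfl
    have huE : A *ᵥ u = μ • u := by rw [hAu, hu, smul_sub, smul_comm]
    refine ⟨c, ?_⟩
    ext j
    by_cases hj : j ∈ S
    · have := eq_zero_of_reflTransGen hA hu0 huE hui (hconn i hiS j hj)
      have h' : c * v j - w j = 0 := by simpa [hu] using this
      simpa using (sub_eq_zero.1 h').symm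
    · simp [hv0 j hj, hw0 j hj]

end PerronFrobenius

section Chain

open Matrix Relation

variable {Ns Ne : ℕ}

/-- The transposition of the sites `x` and `x + 1`. -/
def bondSwap (x : ZMod Ns) : Equiv.Perm (ZMod Ns) := Equiv.swap x (x + 1)

/-- Exactly one of the sites `x`, `x + 1` is occupied. -/
def HopBond (ω : ChainCfg Ns) (x : ZMod Ns) : Prop := (ω x).isSome ≠ (ω (x + 1)).isSome

/-- The sites `x`, `x + 1` carry opposite spins. -/
def AntiparallelBond (ω : ChainCfg Ns) (x : ZMod Ns) : Prop :=
  (ω x = some true ∧ ω (x + 1) = some false) ∨ (ω x = some false ∧ ω (x + 1) = some true)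

theorem HopBond.ne {ω : ChainCfg Ns} {x : ZMod Ns} (h : HopBond ω x) : ω x ≠ ω (x + 1) :=
  fun h' => h (by rw [h'])

theorem AntiparallelBond.ne {ω : ChainCfg Ns} {x : ZMod Ns} (h : AntiparallelBond ω x) :
    ω x ≠ ω (x + 1) := by
  rcases h with ⟨h1, h2⟩ | ⟨h1, h2⟩ <;> simp [h1, h2]

theorem AntiparallelBond.not_hopBond {ω : ChainCfg Ns} {x : ZMod Ns} (h : AntiparallelBond ω x) :
    ¬ HopBond ω x := by
  rcases h with ⟨h1, h2⟩ | ⟨h1, h2⟩ <;> simp [HopBond, h1, h2]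

theorem hopBond_or_antiparallelBond {ω : ChainCfg Ns} {x : ZMod Ns} (h : ω x ≠ ω (x + 1)) :
    HopBond ω x ∨ AntiparallelBond ω x := by
  unfold HopBond AntiparallelBond
  rcases hx : ω x with _ | _ | _ <;> rcases hy : ω (x + 1) with _ | _ | _ <;> simp_all

theorem add_one_ne_self_of_three_le (hNs : 3 ≤ Ns) (x : ZMod Ns) : x + 1 ≠ x := by
  have : Fact (1 < Ns) := ⟨by omega⟩
  simp

theorem add_one_add_one_ne_self_of_three_le (hNs : 3 ≤ Ns) (x : ZMod Ns) : x + 1 + 1 ≠ x := by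
  intro h
  have h2 : ((2 : ℕ) : ZMod Ns) = 0 := by
    push_cast
    linear_combination h
  exact absurd (Nat.le_of_dvd (by norm_num) ((ZMod.natCast_eq_zero_iff 2 Ns).1 h2)) (by omega)

theorem bondSwap_involutive (x : ZMod Ns) (ω : ChainCfg Ns) :
    (ω ∘ bondSwap x) ∘ bondSwap x = ω := by
  ext1 y
  simp [bondSwap]

theorem comp_bondSwap_eq_update (ω : ChainCfg Ns) (x : ZMod Ns) :
    ω ∘ bondSwap x
      = Function.update (Function.update ω x (ω (x + 1))) (x + 1) (ω x) := by
  ext1 y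
  simp only [bondSwap, Function.comp_apply, Equiv.swap_apply_def, Function.update_apply]
  split_ifs <;> simp_all

theorem comp_bondSwap_ne {ω : ChainCfg Ns} {x : ZMod Ns} (h : ω x ≠ ω (x + 1)) :
    ω ∘ bondSwap x ≠ ω := by
  intro h'
  have := congrFun h' x
  simp only [bondSwap, Function.comp_apply, Equiv.swap_apply_left] at this
  exact h this.symm

/-- On a ring of at least three sites, distinct nontrivial bond exchanges give distinct
configurations. -/
theorem eq_of_comp_bondSwap_eq (hNs : 3 ≤ Ns) {ω : ChainCfg Ns} {x y : ZMod Ns}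
    (h : ω x ≠ ω (x + 1)) (hxy : ω ∘ bondSwap x = ω ∘ bondSwap y) : x = y := by
  by_contra hne
  have h1 := congrFun hxy x
  have h2 := congrFun hxy (x + 1)
  have h3 := add_one_ne_self_of_three_le hNs y
  have h4 := add_one_add_one_ne_self_of_three_le hNs y
  simp only [bondSwap, Function.comp_apply, Equiv.swap_apply_left, Equiv.swap_apply_right,
    Equiv.swap_apply_def] at h1 h2
  have hx : x = y + 1 := by
    by_contra hx
    rw [if_neg hne, if_neg hx] at h1
    exact h h1.symm
  subst hx
  rw [if_neg h4, if_neg (by simpa using h3)] at h2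
  exact h h2

theorem hopBond_comp_bondSwap {ω : ChainCfg Ns} {x : ZMod Ns} :
    HopBond (ω ∘ bondSwap x) x ↔ HopBond ω x := by
  simp [HopBond, bondSwap, eq_comm]

theorem antiparallelBond_comp_bondSwap {ω : ChainCfg Ns} {x : ZMod Ns} :
    AntiparallelBond (ω ∘ bondSwap x) x ↔ AntiparallelBond ω x := by
  simp only [AntiparallelBond, bondSwap, Function.comp_apply, Equiv.swap_apply_left,
    Equiv.swap_apply_right]
  tauto

theorem nnHop_iff {ω ω' : ChainCfg Ns} :
    NNHop ω ω' ↔ ∃ x, HopBond ω x ∧ ω' = ω ∘ bondSwap x := by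
  unfold NNHop
  refine exists_congr fun x => ?_
  rw [comp_bondSwap_eq_update]
  by_cases hx : x + 1 = x
  · simp only [HopBond, hx, ne_eq, not_true_eq_false, false_and, or_self_iff, iff_false]
    tauto
  by_cases h1 : ω x = none <;> by_cases h2 : ω (x + 1) = none
  · simp [HopBond, h1, h2]
  · rw [Function.update_comm hx]
    simp [HopBond, h1, h2]
  · simp [HopBond, h1, h2]
  · simp [HopBond, h1, h2, Option.isSome_iff_ne_none.2 h1, Option.isSome_iff_ne_none.2 h2]

theorem spinExch_iff {ω ω' : ChainCfg Ns} :
    SpinExch ω ω' ↔ ∃ x, AntiparallelBond ω x ∧ ω' = ω ∘ bondSwap x := by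
  unfold SpinExch
  simp only [comp_bondSwap_eq_update, AntiparallelBond]

theorem nnHop_comm {ω ω' : ChainCfg Ns} : NNHop ω ω' ↔ NNHop ω' ω := by
  suffices h : ∀ ω ω' : ChainCfg Ns, NNHop ω ω' → NNHop ω' ω from ⟨h _ _, h _ _⟩
  intro ω ω' h
  obtain ⟨x, hx, rfl⟩ := nnHop_iff.1 h
  exact nnHop_iff.2 ⟨x, hopBond_comp_bondSwap.2 hx, (bondSwap_involutive x ω).symm⟩

theorem spinExch_comm {ω ω' : ChainCfg Ns} : SpinExch ω ω' ↔ SpinExch ω' ω := by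
  suffices h : ∀ ω ω' : ChainCfg Ns, SpinExch ω ω' → SpinExch ω' ω from ⟨h _ _, h _ _⟩
  intro ω ω' h
  obtain ⟨x, hx, rfl⟩ := spinExch_iff.1 h
  exact spinExch_iff.2 ⟨x, antiparallelBond_comp_bondSwap.2 hx, (bondSwap_involutive x ω).symm⟩

variable [NeZero Ns]

theorem card_filter_comp_perm (π : Equiv.Perm (ZMod Ns)) (p : ZMod Ns → Prop) [DecidablePred p] :
    (Finset.univ.filter fun x => p (π x)).card = (Finset.univ.filter p).card :=
  Finset.card_bijective π π.bijective (by simp)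

theorem upNum_comp_perm (π : Equiv.Perm (ZMod Ns)) (ω : ChainCfg Ns) :
    upNum (ω ∘ π) = upNum ω :=
  card_filter_comp_perm π fun x => ω x = some true

theorem occNum_comp_perm (π : Equiv.Perm (ZMod Ns)) (ω : ChainCfg Ns) :
    occNum (ω ∘ π) = occNum ω :=
  card_filter_comp_perm π fun x => ω x ≠ none

/-- Relabel the sites of a hard-core configuration by a permutation. -/
def HardCoreCfg.permute (π : Equiv.Perm (ZMod Ns)) (ω : HardCoreCfg Ns Ne) : HardCoreCfg Ns Ne :=
  ⟨ω.1 ∘ π, (occNum_comp_perm π ω.1).trans ω.2⟩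

/-- The configuration with the same occupied sites and all spins down. -/
def HardCoreCfg.allDown (ω : HardCoreCfg Ns Ne) : HardCoreCfg Ns Ne :=
  ⟨fun x => (ω.1 x).map fun _ => false, by
    refine Eq.trans ?_ ω.2
    simp [occNum]⟩

theorem HardCoreCfg.upNum_allDown (ω : HardCoreCfg Ns Ne) : upNum ω.allDown.1 = 0 := by
  simp [upNum, HardCoreCfg.allDown]

theorem HardCoreCfg.upNum_permute (π : Equiv.Perm (ZMod Ns)) (ω : HardCoreCfg Ns Ne) :
    upNum (ω.permute π).1 = upNum ω.1 :=
  upNum_comp_perm π ω.1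

theorem tJHam_isSymm (t J : ℝ) : (tJHam Ns Ne t J).IsSymm := by
  ext ω ω'
  classical
  refine if_congr nnHop_comm rfl (if_congr spinExch_comm rfl ?_)
  by_cases h : ω = ω'
  · subst h; rfl
  · rw [if_neg h, if_neg fun h' => h h'.symm]

theorem tJHam_nonpos {t J : ℝ} (ht : 0 < t) (hJ : 0 < J) {ω ω' : HardCoreCfg Ns Ne}
    (h : ω ≠ ω') : tJHam Ns Ne t J ω ω' ≤ 0 := by
  unfold tJHam
  split_ifs <;> linarith

theorem tJHam_permute_bondSwap_neg {t J : ℝ} (ht : 0 < t) (hJ : 0 < J) (ω : HardCoreCfg Ns Ne)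
    {x : ZMod Ns} (h : ω.1 x ≠ ω.1 (x + 1)) :
    tJHam Ns Ne t J ω (ω.permute (bondSwap x)) < 0 := by
  unfold tJHam
  split_ifs with h1 h2 h3
  · linarith
  · linarith
  all_goals
    exfalso
    rcases hopBond_or_antiparallelBond h with hx | hx
    · exact h1 (nnHop_comm.1 (nnHop_iff.2 ⟨x, hx, rfl⟩))
    · exact h2 (spinExch_comm.1 (spinExch_iff.2 ⟨x, hx, rfl⟩))

theorem upNum_eq_of_tJHam_neg {t J : ℝ} (hJ : 0 < J) {ω ω' : HardCoreCfg Ns Ne}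
    (h : tJHam Ns Ne t J ω ω' < 0) : upNum ω.1 = upNum ω'.1 := by
  unfold tJHam at h
  split_ifs at h with h1 h2 h3
  · obtain ⟨x, -, hx⟩ := nnHop_iff.1 h1
    rw [hx, upNum_comp_perm]
  · obtain ⟨x, -, hx⟩ := spinExch_iff.1 h2
    rw [hx, upNum_comp_perm]
  · exact absurd h (not_lt.2 (by positivity))
  · exact absurd h (lt_irrefl 0)

open Classical in
theorem tJHam_apply (hNs : 3 ≤ Ns) (t J : ℝ) (ω ω' : HardCoreCfg Ns Ne) :
    tJHam Ns Ne t J ω ω' = ∑ x, if HopBond ω.1 x then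
        -t * (if ω' = ω.permute (bondSwap x) then 1 else 0)
      else if AntiparallelBond ω.1 x then
        (J / 2) * ((if ω' = ω then 1 else 0)
          - (if ω' = ω.permute (bondSwap x) then 1 else 0))
      else 0 := by
  have hself : ∀ {x}, ω.1 x ≠ ω.1 (x + 1) → ω.permute (bondSwap x) ≠ ω := fun h h' =>
    comp_bondSwap_ne h (congrArg Subtype.val h')
  have hinj : ∀ {x y}, ω.1 x ≠ ω.1 (x + 1) → y ≠ x →
      ω.permute (bondSwap x) ≠ ω.permute (bondSwap y) := fun h hxy h' =>
    hxy (eq_of_comp_bondSwap_eq hNs h (congrArg Subtype.val h')).symm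
  unfold tJHam
  simp only [nnHop_comm (ω := ω'.1), spinExch_comm (ω := ω'.1)]
  by_cases h1 : NNHop ω.1 ω'.1
  · rw [if_pos h1]
    obtain ⟨x, hx, hω⟩ := nnHop_iff.1 h1
    obtain rfl : ω' = ω.permute (bondSwap x) := Subtype.ext hω
    rw [Finset.sum_eq_single x]
    · simp [hx]
    · intro y _ hy
      simp [hinj hx.ne hy, hself hx.ne]
    · simp
  rw [if_neg h1]
  by_cases h2 : SpinExch ω.1 ω'.1
  · rw [if_pos h2]
    obtain ⟨x, hx, hω⟩ := spinExch_iff.1 h2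
    obtain rfl : ω' = ω.permute (bondSwap x) := Subtype.ext hω
    rw [Finset.sum_eq_single x]
    · simp [hx, hx.not_hopBond, hself hx.ne]
    · intro y _ hy
      simp [hinj hx.ne hy, hself hx.ne]
    · simp
  rw [if_neg h2]
  by_cases h3 : ω' = ω
  · subst h3
    rw [if_pos rfl]
    have hcount : (antiparallelCount ω'.1 : ℝ)
        = ∑ x, if AntiparallelBond ω'.1 x then 1 else 0 := by
      rw [Finset.sum_boole]
      unfold antiparallelCount AntiparallelBond
      congr!
    rw [hcount, Finset.mul_sum]
    refine Finset.sum_congr rfl fun x _ => ?_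
    by_cases hh : HopBond ω'.1 x
    · have ha : ¬ AntiparallelBond ω'.1 x := fun ha => ha.not_hopBond hh
      simp [hh, ha, (hself hh.ne).symm]
    · by_cases ha : AntiparallelBond ω'.1 x
      · simp [hh, ha, (hself ha.ne).symm]
      · simp [hh, ha]
  · rw [if_neg fun h => h3 h.symm]
    refine (Finset.sum_eq_zero fun x _ => ?_).symm
    by_cases hh : HopBond ω.1 x
    · have h4 : ω' ≠ ω.permute (bondSwap x) := fun h4 =>
        h1 (nnHop_iff.2 ⟨x, hh, congrArg Subtype.val h4⟩)
      simp [hh, h4]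
    · by_cases ha : AntiparallelBond ω.1 x
      · have h4 : ω' ≠ ω.permute (bondSwap x) := fun h4 =>
          h2 (spinExch_iff.2 ⟨x, ha, congrArg Subtype.val h4⟩)
        simp [hh, ha, h3, h4]
      · simp [hh, ha]

open Classical in
/-- The action of the Hamiltonian as a sum over the bonds of the ring. -/
theorem tJHam_mulVec (hNs : 3 ≤ Ns) (t J : ℝ) (Φ : HardCoreCfg Ns Ne → ℝ)
    (ω : HardCoreCfg Ns Ne) :
    (tJHam Ns Ne t J *ᵥ Φ) ω = ∑ x, if HopBond ω.1 x then -t * Φ (ω.permute (bondSwap x))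
      else if AntiparallelBond ω.1 x then (J / 2) * (Φ ω - Φ (ω.permute (bondSwap x)))
      else 0 := by
  simp only [mulVec, dotProduct, tJHam_apply hNs, Finset.sum_mul]
  rw [Finset.sum_comm]
  refine Finset.sum_congr rfl fun x _ => ?_
  split_ifs <;>
    simp [mul_assoc, sub_mul, ← Finset.mul_sum, Finset.sum_sub_distrib]

theorem closure_range_bondSwap :
    Subgroup.closure (Set.range (bondSwap (Ns := Ns))) = ⊤ := by
  have h : ∀ (x : ZMod Ns) (k : ℕ),
      Equiv.swap x (x + k) ∈ Subgroup.closure (Set.range (bondSwap (Ns := Ns))) := by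
    intro x k
    induction k with
    | zero => simp [← Equiv.Perm.one_def, one_mem]
    | succ k ih =>
      refine SubmonoidClass.swap_mem_trans _ ih ?_
      refine Subgroup.subset_closure ⟨x + k, ?_⟩
      simp [bondSwap, add_assoc]
  rw [eq_top_iff, ← Equiv.Perm.closure_isSwap, Subgroup.closure_le]
  rintro _ ⟨x, y, -, rfl⟩
  simpa using h x (y - x).val

/-- Configurations with the same numbers of electrons and of up spins differ by a permutation of
the sites. -/
theorem HardCoreCfg.exists_eq_permute {ω ω' : HardCoreCfg Ns Ne}
    (h : upNum ω.1 = upNum ω'.1) : ∃ π, ω' = ω.permute π := by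
  have hcard : ∀ c, (Finset.univ.filter fun x => ω'.1 x = c).card
      = (Finset.univ.filter fun x => ω.1 x = c).card := by
    have hocc : occNum ω'.1 = occNum ω.1 := ω'.2.trans ω.2.symm
    have hsplit : ∀ σ : ChainCfg Ns,
        occNum σ = upNum σ + (Finset.univ.filter fun x => σ x = some false).card := by
      intro σ
      rw [occNum, upNum, ← Finset.card_union_of_disjoint]
      · congr 1
        ext x
        rcases hx : σ x with _ | _ | _ <;> simp [hx]
      · rw [Finset.disjoint_filter]
        intro x _ hx
        simp [hx]
    have hnone : ∀ σ : ChainCfg Ns,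
        (Finset.univ.filter fun x => σ x = none).card + occNum σ = Fintype.card (ZMod Ns) := by
      intro σ
      exact Finset.card_filter_add_card_filter_not _
    have h1 := hsplit ω.1
    have h2 := hsplit ω'.1
    have h3 := hnone ω.1
    have h4 := hnone ω'.1
    rintro (_ | _ | _)
    · omega
    · omega
    · exact h.symm
  have he : ∀ c, Nonempty ({x // ω'.1 x = c} ≃ {x // ω.1 x = c}) := fun c =>
    Fintype.card_eq.1 (by rw [Fintype.card_subtype, Fintype.card_subtype]; exact hcard c)
  let e := fun c => (he c).some
  refine ⟨Equiv.ofFiberEquiv e, Subtype.ext (funext fun x => ?_)⟩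
  exact (Equiv.ofFiberEquiv_map e x).symm

/-- The Hamiltonian connects any two configurations of a magnetization sector. -/
theorem tJHam_connected {t J : ℝ} (ht : 0 < t) (hJ : 0 < J) {ω ω' : HardCoreCfg Ns Ne}
    (h : upNum ω.1 = upNum ω'.1) :
    ReflTransGen (fun a b => tJHam Ns Ne t J a b < 0) ω ω' := by
  obtain ⟨π, rfl⟩ := HardCoreCfg.exists_eq_permute h
  have hsymm : ∀ a b : HardCoreCfg Ns Ne,
      ReflTransGen (fun a b => tJHam Ns Ne t J a b < 0) a b →
      ReflTransGen (fun a b => tJHam Ns Ne t J a b < 0) b a := by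
    intro a b hab
    have := reflTransGen_swap.2 hab
    refine ReflTransGen.mono ?_ _ _ this
    intro c d hcd
    exact ((tJHam_isSymm t J).apply d c).trans_lt hcd
  have hπ : π ∈ Subgroup.closure (Set.range (bondSwap (Ns := Ns))) := by
    rw [closure_range_bondSwap]; trivial
  clear h
  induction hπ using Subgroup.closure_induction generalizing ω with
  | mem _ hx =>
    obtain ⟨x, rfl⟩ := hx
    by_cases hx : ω.1 x = ω.1 (x + 1)
    · have : ω.permute (bondSwap x) = ω := by
        refine Subtype.ext ?_
        simp [HardCoreCfg.permute, comp_bondSwap_eq_update, hx]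
        simp [← hx]
      rw [this]
    · exact .single (tJHam_permute_bondSwap_neg ht hJ ω hx)
  | one => exact .refl
  | mul π₁ π₂ _ _ h₁ h₂ => exact (h₁ (ω := ω)).trans (h₂ (ω := ω.permute π₁))
  | inv π _ h =>
    have := h (ω := ω.permute π⁻¹)
    have hback : (ω.permute π⁻¹).permute π = ω := by
      refine Subtype.ext (funext fun x => ?_)
      simp [HardCoreCfg.permute]
    rw [hback] at this
    exact hsymm _ _ this

/-- Every magnetization sector is nonempty. -/
theorem HardCoreCfg.exists_upNum_eq (hNe : Ne ≤ Ns) {n : ℕ} (hn : n ≤ Ne) :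
    ∃ ω : HardCoreCfg Ns Ne, upNum ω.1 = n := by
  obtain ⟨U, -, hU⟩ := Finset.exists_subset_card_eq (s := (Finset.univ : Finset (ZMod Ns)))
    (n := Ne) (by simpa [ZMod.card] using hNe)
  obtain ⟨T, hTU, hT⟩ := Finset.exists_subset_card_eq (s := U) (n := n) (by rwa [hU])
  refine ⟨⟨fun x => if x ∈ T then some true else if x ∈ U then some false else none, ?_⟩, ?_⟩
  · rw [← hU, occNum]
    congr 1
    ext x
    by_cases h1 : x ∈ T
    · simp [h1, hTU h1]
    · by_cases h2 : x ∈ U <;> simp [h1, h2]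
  · rw [← hT, upNum]
    congr 1
    ext x
    by_cases h1 : x ∈ T
    · simp [h1]
    · by_cases h2 : x ∈ U <;> simp [h1]

/-- The restriction of a vector to the `n`-th magnetization sector. -/
def sectorPart (n : ℕ) (Φ : HardCoreCfg Ns Ne → ℝ) : HardCoreCfg Ns Ne → ℝ :=
  fun ω => if upNum ω.1 = n then Φ ω else 0

theorem tJHam_mulVec_sectorPart (hNs : 3 ≤ Ns) (t J : ℝ) (n : ℕ) (Φ : HardCoreCfg Ns Ne → ℝ) :
    tJHam Ns Ne t J *ᵥ sectorPart n Φ = sectorPart n (tJHam Ns Ne t J *ᵥ Φ) := by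
  classical
  ext ω
  simp only [sectorPart, tJHam_mulVec hNs, HardCoreCfg.upNum_permute]
  by_cases h : upNum ω.1 = n <;> simp [h]

/-- On functions of the occupied sites alone, the Hamiltonian acts as in the all-down sector. -/
theorem tJHam_mulVec_comp_allDown (hNs : 3 ≤ Ns) (t J : ℝ) (g : HardCoreCfg Ns Ne → ℝ) :
    tJHam Ns Ne t J *ᵥ (fun ω => g ω.allDown)
      = fun ω => (tJHam Ns Ne t J *ᵥ g) ω.allDown := by
  classical
  ext ω
  rw [tJHam_mulVec hNs, tJHam_mulVec hNs]
  refine Finset.sum_congr rfl fun x _ => ?_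
  have h1 : HopBond ω.allDown.1 x ↔ HopBond ω.1 x := by
    simp [HopBond, HardCoreCfg.allDown]
  have h2 : ¬ AntiparallelBond ω.allDown.1 x := by
    simp [AntiparallelBond, HardCoreCfg.allDown]
  have h3 : (ω.permute (bondSwap x)).allDown = ω.allDown.permute (bondSwap x) := rfl
  have h4 (ha : AntiparallelBond ω.1 x) : ω.allDown.permute (bondSwap x) = ω.allDown := by
    refine Subtype.ext ?_
    have hx : ω.allDown.1 x = some false ∧ ω.allDown.1 (x + 1) = some false := by
      rcases ha with ⟨ha, hb⟩ | ⟨ha, hb⟩ <;> simp [HardCoreCfg.allDown, ha, hb]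
    change ω.allDown.1 ∘ bondSwap x = ω.allDown.1
    rw [comp_bondSwap_eq_update, hx.1, hx.2]
    nth_rw 1 [← hx.1]
    rw [Function.update_eq_self, ← hx.2, Function.update_eq_self]
  by_cases hh : HopBond ω.1 x
  · simp [h1, hh, h3]
  · by_cases ha : AntiparallelBond ω.1 x <;> simp [h1, h2, hh, ha, h3, h4]

/-- There is a positive function of the occupied sites alone that is an eigenvector of the
Hamiltonian. -/
theorem exists_pos_tJHam_eigenvector (hNs : 3 ≤ Ns) (hNe : Ne ≤ Ns) {t J : ℝ} (ht : 0 < t)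
    (hJ : 0 < J) :
    ∃ (E : ℝ) (Φ : HardCoreCfg Ns Ne → ℝ), (∀ ω, 0 < Φ ω) ∧
      tJHam Ns Ne t J *ᵥ Φ = E • Φ := by
  classical
  let p : HardCoreCfg Ns Ne → Prop := fun ω => upNum ω.1 = 0
  obtain ⟨ω₀, h₀⟩ := HardCoreCfg.exists_upNum_eq hNe (Nat.zero_le Ne)
  have : Nonempty (Subtype p) := ⟨⟨ω₀, h₀⟩⟩
  set A : Matrix (Subtype p) (Subtype p) ℝ :=
    (tJHam Ns Ne t J).submatrix Subtype.val Subtype.val with hA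
  have hconn : ∀ i j : Subtype p, ReflTransGen (fun a b => A a b < 0) i j := by
    intro i ⟨j, hj⟩
    have hij := tJHam_connected ht hJ (i.2.trans hj.symm)
    induction hij with
    | refl => exact .refl
    | tail _ hbc ih =>
      have hb := (upNum_eq_of_tJHam_neg hJ hbc).trans hj
      exact (ih hb).tail hbc
  obtain ⟨E, v, hv, hvE⟩ := exists_pos_eigenvector (A := A) ((tJHam_isSymm t J).submatrix _)
    (fun i j hij => tJHam_nonpos ht hJ fun h => hij (Subtype.ext h)) hconn
  set g : HardCoreCfg Ns Ne → ℝ := fun ω => if h : p ω then v ⟨ω, h⟩ else 0 with hg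
  have hgE : ∀ i : Subtype p, (tJHam Ns Ne t J *ᵥ g) i.1 = E * v i := by
    intro i
    have h1 : (tJHam Ns Ne t J *ᵥ g) i.1 = (A *ᵥ v) i := by
      simp only [mulVec, dotProduct]
      rw [← Finset.sum_subset (Finset.subset_univ (Finset.univ.filter p)),
        Finset.sum_subtype (p := p) _ (by simp)]
      · refine Finset.sum_congr rfl fun j _ => ?_
        simp [hg, hA, j.2]
      · intro ω _ hω
        have : ¬ p ω := by simpa using hω
        simp [hg, this]
    rw [h1, hvE]
    rfl
  have hdown : ∀ ω : HardCoreCfg Ns Ne, g ω.allDown = v ⟨ω.allDown, ω.upNum_allDown⟩ := fun ω =>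
    dif_pos ω.upNum_allDown
  refine ⟨E, fun ω => g ω.allDown, fun ω => ?_, ?_⟩
  · exact (hv _).trans_eq (hdown ω).symm
  · rw [tJHam_mulVec_comp_allDown hNs]
    ext ω
    rw [hgE ⟨ω.allDown, ω.upNum_allDown⟩, Pi.smul_apply, hdown, smul_eq_mul]

theorem upNum_le (ω : HardCoreCfg Ns Ne) : upNum ω.1 ≤ Ne := by
  refine (Finset.card_le_card fun x hx => ?_).trans_eq ω.2
  simp only [Finset.mem_filter, Finset.mem_univ, true_and] at hx ⊢
  simp [hx]

theorem sum_sectorPart (Φ : HardCoreCfg Ns Ne → ℝ) :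
    ∑ n : Fin (Ne + 1), sectorPart n Φ = Φ := by
  ext ω
  rw [Finset.sum_apply,
    Finset.sum_eq_single (⟨upNum ω.1, Nat.lt_succ_of_le (upNum_le ω)⟩ : Fin (Ne + 1))]
  · simp [sectorPart]
  · intro n _ hn
    exact if_neg fun h => hn (Fin.ext h.symm)
  · simp

end Chain

/-- **Theorem 7.1: ferromagnetism in the one-dimensional ferromagnetic `t`-`J` model at
`U = ∞`.** For odd `Ne ≤ Ns` and `t, J > 0`, there is a single value `E` such that, for
each magnetization sector `n ∈ {0, …, Ne}`, `E` is the smallest eigenvalue of the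
restriction of the Hamiltonian to the sector and this lowest eigenvalue is simple;
moreover `E` is the ground-state energy and the full ground-state eigenspace has
dimension exactly `Ne + 1`. -/
theorem tJ_chain_ferromagnetism (Ns Ne : ℕ) [NeZero Ns] (hNs : 3 ≤ Ns)
    (hNe1 : 1 ≤ Ne) (hNe2 : Ne ≤ Ns) (hodd : Odd Ne) (t J : ℝ)
    (ht : 0 < t) (hJ : 0 < J) :
    ∃ E : ℝ,
      (∀ n : ℕ, n ≤ Ne →
        ∃ Φ₀ : HardCoreCfg Ns Ne → ℝ, Φ₀ ≠ 0 ∧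
          (∀ ω, upNum ω.1 ≠ n → Φ₀ ω = 0) ∧
          (tJHam Ns Ne t J).mulVec Φ₀ = E • Φ₀ ∧
          IsLeast {μ : ℝ | ∃ Φ : HardCoreCfg Ns Ne → ℝ, Φ ≠ 0 ∧
            (∀ ω, upNum ω.1 ≠ n → Φ ω = 0) ∧
            (tJHam Ns Ne t J).mulVec Φ = μ • Φ} E ∧
          (∀ Φ : HardCoreCfg Ns Ne → ℝ, (∀ ω, upNum ω.1 ≠ n → Φ ω = 0) →
            (tJHam Ns Ne t J).mulVec Φ = E • Φ → ∃ c : ℝ, Φ = c • Φ₀)) ∧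
      IsLeast {μ : ℝ | ∃ Φ : HardCoreCfg Ns Ne → ℝ, Φ ≠ 0 ∧
        (tJHam Ns Ne t J).mulVec Φ = μ • Φ} E ∧
      Module.finrank ℝ
        (Module.End.eigenspace (tJHam Ns Ne t J).mulVecLin E) = Ne + 1 := by
  obtain ⟨E, Φ, hΦ, hΦE⟩ := exists_pos_tJHam_eigenvector (Ne := Ne) hNs hNe2 ht hJ
  have hpart : ∀ {μ : ℝ} {Ψ : HardCoreCfg Ns Ne → ℝ} (n : ℕ),
      (tJHam Ns Ne t J).mulVec Ψ = μ • Ψ →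
      (tJHam Ns Ne t J).mulVec (sectorPart n Ψ) = μ • sectorPart n Ψ := by
    intro μ Ψ n h
    rw [tJHam_mulVec_sectorPart hNs, h]
    ext ω
    simp [sectorPart]
  have hsupp : ∀ (n : ℕ) (Ψ : HardCoreCfg Ns Ne → ℝ) (ω : HardCoreCfg Ns Ne),
      upNum ω.1 ≠ n → sectorPart n Ψ ω = 0 := fun n Ψ ω h => if_neg h
  have hne : ∀ n : ℕ, n ≤ Ne → sectorPart n Φ ≠ 0 := by
    intro n hn h
    obtain ⟨ω, hω⟩ := HardCoreCfg.exists_upNum_eq hNe2 hn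
    have h0 := congrFun h ω
    simp only [sectorPart, if_pos hω, Pi.zero_apply] at h0
    exact (hΦ ω).ne' h0
  have hmin : ∀ (n : ℕ) {μ : ℝ} {Ψ : HardCoreCfg Ns Ne → ℝ},
      (∀ ω, upNum ω.1 ≠ n → Ψ ω = 0) → (tJHam Ns Ne t J).mulVec Ψ = μ • Ψ → Ψ ≠ 0 →
      E ≤ μ ∧ (μ = E → ∃ c : ℝ, Ψ = c • sectorPart n Φ) := by
    intro n μ Ψ h0 hμ hΨ
    refine pos_eigenvector_minimal (S := {ω | upNum ω.1 = n})
      (fun i j hij => tJHam_nonpos ht hJ hij)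
      (fun i hi j hj => tJHam_connected ht hJ (Eq.trans hi (Eq.symm hj)))
      (fun i hi => ?_) (hsupp n Φ) h0 (hpart n hΦE) hμ hΨ
    exact (hΦ i).trans_eq (if_pos hi).symm
  have huniq : ∀ (n : ℕ) (Ψ : HardCoreCfg Ns Ne → ℝ), (∀ ω, upNum ω.1 ≠ n → Ψ ω = 0) →
      (tJHam Ns Ne t J).mulVec Ψ = E • Ψ → ∃ c : ℝ, Ψ = c • sectorPart n Φ := by
    intro n Ψ h0 hE
    by_cases hΨ : Ψ = 0
    · exact ⟨0, by simp [hΨ]⟩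
    · exact (hmin n h0 hE hΨ).2 rfl
  refine ⟨E, fun n hn => ⟨sectorPart n Φ, hne n hn, hsupp n Φ, hpart n hΦE,
    ⟨⟨sectorPart n Φ, hne n hn, hsupp n Φ, hpart n hΦE⟩, ?_⟩, huniq n⟩, ⟨⟨Φ, ?_, hΦE⟩, ?_⟩, ?_⟩
  · rintro μ ⟨Ψ, hΨ, h0, hμ⟩
    exact (hmin n h0 hμ hΨ).1
  · rintro rfl
    exact hne 0 (Nat.zero_le _) (by ext ω; simp [sectorPart])
  · rintro μ ⟨Ψ, hΨ, hμ⟩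
    obtain ⟨ω, hω⟩ := Function.ne_iff.1 hΨ
    refine (hmin (upNum ω.1) (hsupp _ Ψ) (hpart _ hμ) fun h => hω ?_).1
    simpa [sectorPart] using congrFun h ω
  · have hli : LinearIndependent ℝ fun n : Fin (Ne + 1) => sectorPart (n : ℕ) Φ := by
      rw [Fintype.linearIndependent_iff]
      intro c hc n
      obtain ⟨ω, hω⟩ := HardCoreCfg.exists_upNum_eq hNe2 (Nat.le_of_lt_succ n.2)
      have h1 := congrFun hc ω
      rw [Finset.sum_apply, Finset.sum_eq_single n] at h1
      · simpa [sectorPart, hω, (hΦ ω).ne'] using h1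
      · intro m _ hm
        have : upNum ω.1 ≠ m := fun h => hm (Fin.ext (h.symm.trans hω))
        simp [sectorPart, this]
      · simp
    have hspan : Module.End.eigenspace (tJHam Ns Ne t J).mulVecLin E
        = Submodule.span ℝ (Set.range fun n : Fin (Ne + 1) => sectorPart (n : ℕ) Φ) := by
      refine le_antisymm (fun Ψ hΨ => ?_) (Submodule.span_le.2 ?_)
      · have hE : (tJHam Ns Ne t J).mulVec Ψ = E • Ψ := Module.End.mem_eigenspace_iff.1 hΨ
        rw [← sum_sectorPart Ψ]
        refine Submodule.sum_mem _ fun n _ => ?_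
        obtain ⟨c, hc⟩ := huniq n _ (hsupp n Ψ) (hpart n hE)
        rw [hc]
        exact Submodule.smul_mem _ _ (Submodule.subset_span ⟨n, rfl⟩)
      · rintro _ ⟨n, rfl⟩
        exact Module.End.mem_eigenspace_iff.2 (hpart n hΦE)
    rw [hspan, finrank_span_eq_card hli, Fintype.card_fin]
end
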